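/- Let V be an optimal computer and let T ∈ (0,1). If the partition function Z_V(T) = Σ_{p ∈ Dom V} 2^{−|p|/T} is a computable real, then T is weakly Chaitin T-random and T-compressible (hence lim_{n→∞} H(T↾n)/n = T). -/

import Mathlib

open Filter Topology

/-- A set of finite binary strings is prefix-free if no string in it is a
proper prefix of another string in it. -/
def PrefixFree (S : Set (List Bool)) : Prop :=
  ∀ p ∈ S, ∀ q ∈ S, p <+: q → p = q

/-- A computer: a partial recursive function from finite binary strings to
finite binary strings whose domain is a nonempty prefix-free set. -/
structure Computer where
  f : List Bool →. List Bool
  partrec : Partrec f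
  dom_nonempty : f.Dom.Nonempty
  dom_prefixFree : PrefixFree f.Dom

/-- A computer `U` is optimal if for each computer `C` there is `d ∈ ℕ` such
that every `p ∈ Dom C` admits `q` with `U(q) = C(p)` and `|q| ≤ |p| + d`. -/
def Optimal (U : Computer) : Prop :=
  ∀ C : Computer, ∃ d : ℕ, ∀ p ∈ C.f.Dom,
    ∃ q : List Bool, U.f q = C.f p ∧ q.length ≤ p.length + d

/-- `H_C(s)`: the length of a shortest program for `C` printing `s`. -/
noncomputable def complexity (C : Computer) (s : List Bool) : ℕ :=
  sInf {n | ∃ p : List Bool, s ∈ C.f p ∧ p.length = n}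

/-- The `i`-th bit (for `i = 0, 1, 2, …`) of the base-two expansion of
`α - ⌊α⌋` with infinitely many zeros. -/
noncomputable def bitOf (α : ℝ) (i : ℕ) : Bool :=
  decide (⌊(α - ⌊α⌋) * 2 ^ (i + 1)⌋ % 2 = 1)

/-- `α↾n`: the first `n` bits of the base-two expansion of `α - ⌊α⌋`
with infinitely many zeros. -/
noncomputable def firstBits (α : ℝ) (n : ℕ) : List Bool :=
  (List.range n).map (bitOf α)

/-- A real `α` is computable if some total recursive `f : ℕ⁺ → ℚ` satisfies
`|α - f n| < 1/n` for all `n ≥ 1`. -/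
def ComputableReal (α : ℝ) : Prop :=
  ∃ f : ℕ → ℚ, Computable f ∧ ∀ n : ℕ, 0 < n → |α - (f n : ℝ)| < 1 / n

/-- `α` is weakly Chaitin `T`-random (w.r.t. the computer `U`). -/
def WeaklyChaitinTRandom (U : Computer) (T α : ℝ) : Prop :=
  ∃ c : ℕ, ∀ n : ℕ, 0 < n → T * n - c ≤ (complexity U (firstBits α n) : ℝ)

/-- `α` is Chaitin `T`-random (w.r.t. the computer `U`). -/
def ChaitinTRandom (U : Computer) (T α : ℝ) : Prop :=
  Tendsto (fun n : ℕ => (complexity U (firstBits α n) : ℝ) - T * n) atTop atTop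

/-- `α` is `T`-compressible (w.r.t. the computer `U`): `H(α↾n) ≤ Tn + o(n)`. -/
def TCompressible (U : Computer) (T α : ℝ) : Prop :=
  ∃ g : ℕ → ℝ, Tendsto (fun n : ℕ => g n / n) atTop (nhds 0) ∧
    ∀ n : ℕ, 0 < n → (complexity U (firstBits α n) : ℝ) ≤ T * n + g n

/-- The Boltzmann factor `2^(-|p|/T)` of a program `p`. -/
noncomputable def boltzmann (T : ℝ) (p : List Bool) : ℝ :=
  (2 : ℝ) ^ (-(p.length : ℝ) / T)

/-- Partition function `Z_C(T) = Σ_{p ∈ Dom C} 2^(-|p|/T)`. -/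
noncomputable def Zfun (C : Computer) (T : ℝ) : ℝ :=
  ∑' p : C.f.Dom, boltzmann T p.1

/-- Free energy `F_C(T) = -T log₂ Z_C(T)`. -/
noncomputable def Ffun (C : Computer) (T : ℝ) : ℝ :=
  -T * Real.logb 2 (Zfun C T)

/-- Energy `E_C(T) = Z_C(T)⁻¹ Σ_{p ∈ Dom C} |p| 2^(-|p|/T)`. -/
noncomputable def Efun (C : Computer) (T : ℝ) : ℝ :=
  (Zfun C T)⁻¹ * ∑' p : C.f.Dom, (p.1.length : ℝ) * boltzmann T p.1

/-- Statistical mechanical entropy `S_C(T) = (E_C(T) - F_C(T))/T`. -/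
noncomputable def Sfun (C : Computer) (T : ℝ) : ℝ :=
  (Efun C T - Ffun C T) / T

/-- `𝒵(V)`: the set of `T ∈ (0,1)` with `Z_V(T)` computable. -/
def setZ (V : Computer) : Set ℝ := {T | T ∈ Set.Ioo 0 1 ∧ ComputableReal (Zfun V T)}

/-- `ℱ(V)`: the set of `T ∈ (0,1)` with `F_V(T)` computable. -/
def setF (V : Computer) : Set ℝ := {T | T ∈ Set.Ioo 0 1 ∧ ComputableReal (Ffun V T)}

/-- `ℰ(V)`: the set of `T ∈ (0,1)` with `E_V(T)` computable. -/
def setE (V : Computer) : Set ℝ := {T | T ∈ Set.Ioo 0 1 ∧ ComputableReal (Efun V T)}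

/-- `𝒮(V)`: the set of `T ∈ (0,1)` with `S_V(T)` computable. -/
def setS (V : Computer) : Set ℝ := {T | T ∈ Set.Ioo 0 1 ∧ ComputableReal (Sfun V T)}

/-- `FP_w` (w.r.t. the optimal computer `U` fixing `H`): the set of `T ∈ (0,1)`
that are weakly Chaitin `T`-random and `T`-compressible. -/
def FPw (U : Computer) : Set ℝ :=
  {T | T ∈ Set.Ioo 0 1 ∧ WeaklyChaitinTRandom U T T ∧ TCompressible U T T}

/-- `FP` (w.r.t. the optimal computer `U` fixing `H`): the set of `T ∈ (0,1)`
that are Chaitin `T`-random and `T`-compressible. -/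
def FP (U : Computer) : Set ℝ :=
  {T | T ∈ Set.Ioo 0 1 ∧ ChaitinTRandom U T T ∧ TCompressible U T T}

/-- A computer is physically reasonable if its domain contains two strings of
different lengths. -/
def PhysicallyReasonable (C : Computer) : Prop :=
  ∃ p ∈ C.f.Dom, ∃ q ∈ C.f.Dom, p.length ≠ q.length

/-- A computable measure machine: `Z_C(1)` is a computable real. -/
def ComputableMeasureMachine (C : Computer) : Prop :=
  ComputableReal (Zfun C 1)

/-- `D` is the composition `C₀ ⊘ C₁ ⊘ ⋯ ⊘ C_{N-1}`: its domain consists of the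
concatenations `p₀p₁⋯p_{N-1}` with each `pᵢ ∈ Dom Cᵢ`, and on such a
concatenation it returns `C₀(p₀)`. -/
def IsComposition {N : ℕ} (C : Fin N → Computer) (hN : 0 < N) (D : Computer) : Prop :=
  (∀ l, l ∈ D.f.Dom ↔
      ∃ ps : Fin N → List Bool, (∀ i, ps i ∈ (C i).f.Dom) ∧ l = (List.ofFn ps).flatten) ∧
  (∀ ps : Fin N → List Bool, (∀ i, ps i ∈ (C i).f.Dom) →
      D.f ((List.ofFn ps).flatten) = (C ⟨0, hN⟩).f (ps ⟨0, hN⟩))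

/-- A sequence of computers is recursive if a single partial recursive function
uniformly computes all of them. -/
def RecursiveSeq (V : ℕ → Computer) : Prop :=
  ∃ F : ℕ × List Bool →. List Bool, Partrec F ∧ ∀ n p, (V n).f p = F (n, p)

attribute [fun_prop] Computable
/-- Boolean comparison. -/
def leB (a b : ℕ) : Bool := decide (a ≤ b)
/-- Boolean equality. -/
def eqB {β : Type*} [DecidableEq β] (a b : β) : Bool := decide (a = b)
theorem leB_iff {a b : ℕ} : leB a b = true ↔ a ≤ b := by simp [leB]
theorem eqB_iff {β : Type*} [DecidableEq β] {a b : β} : eqB a b = true ↔ a = b := by simp [eqB]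
section
variable {α β γ σ : Type*} [Primcodable α] [Primcodable β] [Primcodable γ] [Primcodable σ]
@[fun_prop] theorem cp_id : Computable (fun x : α => x) := Computable.id
@[fun_prop] theorem cp_const (y : β) : Computable (fun _ : α => y) := Computable.const y
@[fun_prop] theorem cp_comp {f : β → γ} {g : α → β} (hf : Computable f) (hg : Computable g) :
    Computable (fun x => f (g x)) := hf.comp hg
@[fun_prop] theorem cp_fst {f : α → β × γ} (hf : Computable f) : Computable (fun x => (f x).1) :=
  Computable.fst.comp hf
@[fun_prop] theorem cp_snd {f : α → β × γ} (hf : Computable f) : Computable (fun x => (f x).2) :=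
  Computable.snd.comp hf
@[fun_prop] theorem cp_mk {f : α → β} {g : α → γ} (hf : Computable f) (hg : Computable g) :
    Computable (fun x => (f x, g x)) := hf.pair hg
@[fun_prop] theorem cp_add {f g : α → ℕ} (hf : Computable f) (hg : Computable g) :
    Computable (fun x => f x + g x) := Primrec.nat_add.to_comp.comp hf hg
@[fun_prop] theorem cp_mul {f g : α → ℕ} (hf : Computable f) (hg : Computable g) :
    Computable (fun x => f x * g x) := Primrec.nat_mul.to_comp.comp hf hg
@[fun_prop] theorem cp_sub {f g : α → ℕ} (hf : Computable f) (hg : Computable g) :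
    Computable (fun x => f x - g x) := Primrec.nat_sub.to_comp.comp hf hg
@[fun_prop] theorem cp_div {f g : α → ℕ} (hf : Computable f) (hg : Computable g) :
    Computable (fun x => f x / g x) := Primrec.nat_div.to_comp.comp hf hg
@[fun_prop] theorem cp_mod {f g : α → ℕ} (hf : Computable f) (hg : Computable g) :
    Computable (fun x => f x % g x) := Primrec.nat_mod.to_comp.comp hf hg
@[fun_prop] theorem cp_pow {f g : α → ℕ} (hf : Computable f) (hg : Computable g) :
    Computable (fun x => f x ^ g x) :=
  (Primrec₂.to_comp (Primrec₂.unpaired'.1 Nat.Primrec.pow)).comp hf hg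
@[fun_prop] theorem cp_le {f g : α → ℕ} (hf : Computable f) (hg : Computable g) :
    Computable (fun x => leB (f x) (g x)) :=
  (Primrec.nat_le.decide).to_comp.comp hf hg
@[fun_prop] theorem cp_eq [DecidableEq β] {f g : α → β} (hf : Computable f) (hg : Computable g) :
    Computable (fun x => eqB (f x) (g x)) :=
  (Primrec.eq.decide).to_comp.comp hf hg
@[fun_prop] theorem cp_and {f g : α → Bool} (hf : Computable f) (hg : Computable g) :
    Computable (fun x => f x && g x) := Primrec.and.to_comp.comp hf hg
@[fun_prop] theorem cp_or {f g : α → Bool} (hf : Computable f) (hg : Computable g) :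
    Computable (fun x => f x || g x) := Primrec.or.to_comp.comp hf hg
@[fun_prop] theorem cp_cond {c : α → Bool} {f g : α → σ} (hc : Computable c) (hf : Computable f)
    (hg : Computable g) : Computable (fun x => bif c x then f x else g x) :=
  Computable.cond hc hf hg
@[fun_prop] theorem cp_unpair {f : α → ℕ} (hf : Computable f) :
    Computable (fun x => Nat.unpair (f x)) := Computable.unpair.comp hf
@[fun_prop] theorem cp_pair {f g : α → ℕ} (hf : Computable f) (hg : Computable g) :
    Computable (fun x => Nat.pair (f x) (g x)) := Primrec₂.natPair.to_comp.comp hf hg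
theorem cp_sum {f : α → ℕ → ℕ} {n : α → ℕ} (hf : Computable (fun x : α × ℕ => f x.1 x.2))
    (hn : Computable n) : Computable (fun x => ∑ i ∈ Finset.range (n x), f x i) := by
  have h : Computable (fun x : α => (Nat.rec 0 (fun i s => s + f x i) (n x) : ℕ)) := by
    refine Computable.nat_rec hn (cp_const 0) (h := fun x p => p.2 + f x p.1) ?_
    refine Computable₂.mk ?_
    refine cp_add (by fun_prop) ?_
    exact hf.comp (g := fun p : α × ℕ × ℕ => (p.1, p.2.1)) (by fun_prop)
  refine h.of_eq fun x => ?_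
  induction n x with
  | zero => simp
  | succ k ih => simp [Finset.sum_range_succ, ih]
/-- Unbounded search. -/
theorem cp_find {P : α → ℕ → Bool} (hP : Computable (fun x : α × ℕ => P x.1 x.2))
    (h : ∀ a, ∃ n, P a n = true) :
    ∃ F : α → ℕ, Computable F ∧ ∀ a, P a (F a) = true ∧ ∀ m < F a, P a m = false := by
  have h2 := fun a => Nat.rfind_min' (p := P a) (h a).choose_spec
  choose F hF _ using h2
  refine ⟨F, ?_, fun a => ⟨by simpa using (Nat.rfind_spec (hF a)), fun m hm => by
    simpa using (Nat.rfind_min (hF a) hm)⟩⟩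
  refine Partrec.of_eq_tot (f := fun a => Nat.rfind fun n => Part.some (P a n)) ?_ hF
  exact Partrec.rfind (Computable₂.partrec₂ (Computable₂.mk hP))
end

open Encodable in
theorem old_encode_rat (q : ℚ) :
    @Encodable.encode ℚ Rat.instEncodable q = Nat.pair (Encodable.encode q.num) q.den := rfl

theorem encode_int_ofNat (n : ℕ) : Encodable.encode (Int.ofNat n) = 2 * n := rfl
theorem encode_int_negSucc (n : ℕ) : Encodable.encode (Int.negSucc n) = 2 * n + 1 := rfl

theorem ofNat_rat_zero_succ : ∃ K : ℕ → ℕ,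
    (∀ n, K n = @Encodable.encode ℚ Rat.instEncodable (Denumerable.ofNat ℚ n)) ∧
    ∀ n, K n < K (n+1) ∧ ∀ q : ℚ, @Encodable.encode ℚ Rat.instEncodable q ≤ K n ∨
      K (n+1) ≤ @Encodable.encode ℚ Rat.instEncodable q := by
  let e : Encodable ℚ := Rat.instEncodable
  let := @Encodable.decidableRangeEncode ℚ e
  let : Infinite (Set.range (@Encodable.encode ℚ e)) :=
    Infinite.of_injective _ (Equiv.ofInjective _ Encodable.encode_injective).injective
  refine ⟨fun n => (Nat.Subtype.ofNat (Set.range (@Encodable.encode ℚ e)) n : ℕ), fun n => ?_, fun n => ⟨?_, fun q => ?_⟩⟩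
  · have h : Denumerable.ofNat ℚ n = (Encodable.equivRangeEncode ℚ).symm
      (Nat.Subtype.ofNat (Set.range (@Encodable.encode ℚ e)) n) := rfl
    rw [h]
    have := Equiv.apply_symm_apply (Encodable.equivRangeEncode ℚ) (Nat.Subtype.ofNat (Set.range (@Encodable.encode ℚ e)) n)
    exact (congrArg Subtype.val this).symm
  · exact Nat.Subtype.lt_succ_self _
  · by_contra hh
    push Not at hh
    have := Nat.Subtype.succ_le_of_lt (s := Set.range (@Encodable.encode ℚ e)) (x := ⟨Encodable.encode q, q, rfl⟩) (y := Nat.Subtype.ofNat (Set.range (@Encodable.encode ℚ e)) n) hh.1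
    exact absurd (Subtype.coe_le_coe.2 this) (not_le.2 hh.2)

/-- Test for codes of rationals. -/
def ratCodeB (c : ℕ) : Bool :=
  leB 1 c.unpair.2 && eqB (∑ j ∈ Finset.range (c.unpair.2 + 1),
    bif leB 2 j && eqB ((c.unpair.1 / 2 + c.unpair.1 % 2) % j) 0 && eqB (c.unpair.2 % j) 0
      then 1 else 0) 0

theorem cp_ratCodeB : Computable ratCodeB := by
  unfold ratCodeB
  refine cp_and (by fun_prop) (cp_eq (cp_sum ?_ (by fun_prop)) (by fun_prop))
  fun_prop

theorem int_natAbs_code (z : ℤ) :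
    z.natAbs = Encodable.encode z / 2 + Encodable.encode z % 2 := by
  cases z with
  | ofNat n => rw [encode_int_ofNat]; simp
  | negSucc n => rw [encode_int_negSucc]; simp; omega

theorem int_toNat_code (z : ℤ) :
    z.toNat = (Encodable.encode z / 2) * (1 - Encodable.encode z % 2) := by
  cases z with
  | ofNat n => rw [encode_int_ofNat]; simp
  | negSucc n => rw [encode_int_negSucc]; simp; 

theorem coprime_test (a d : ℕ) (hd : 0 < d) : a.Coprime d ↔
    (∑ j ∈ Finset.range (d + 1), bif leB 2 j && eqB (a % j) 0 && eqB (d % j) 0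
      then 1 else 0) = 0 := by
  rw [Finset.sum_eq_zero_iff]
  constructor
  · intro h j hj
    by_contra hne
    have h1 : (leB 2 j && eqB (a % j) 0 && eqB (d % j) 0) = true := by
      by_contra hf
      rw [Bool.not_eq_true] at hf
      rw [hf] at hne; simp at hne
    simp only [Bool.and_eq_true, leB_iff, eqB_iff] at h1
    have := Nat.dvd_gcd (Nat.dvd_of_mod_eq_zero h1.1.2) (Nat.dvd_of_mod_eq_zero h1.2)
    rw [h] at this
    have := Nat.le_of_dvd one_pos this
    omega
  · intro h
    by_contra hc
    have hg : 0 < Nat.gcd a d := Nat.gcd_pos_of_pos_right _ hd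
    have hg1 : Nat.gcd a d ≠ 1 := hc
    have hle : Nat.gcd a d ≤ d := Nat.le_of_dvd hd (Nat.gcd_dvd_right a d)
    have h2 := h (Nat.gcd a d) (by simp; omega)
    have h1 : (leB 2 (Nat.gcd a d) && eqB (a % (Nat.gcd a d)) 0 && eqB (d % (Nat.gcd a d)) 0) = true := by
      simp only [Bool.and_eq_true, leB_iff, eqB_iff]
      exact ⟨⟨by omega, Nat.mod_eq_zero_of_dvd (Nat.gcd_dvd_left a d)⟩,
        Nat.mod_eq_zero_of_dvd (Nat.gcd_dvd_right a d)⟩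
    rw [h1] at h2; simp at h2

theorem ratCodeB_iff (c : ℕ) :
    ratCodeB c = true ↔ ∃ q : ℚ, @Encodable.encode ℚ Rat.instEncodable q = c := by
  constructor
  · intro h
    unfold ratCodeB at h
    rw [Bool.and_eq_true, leB_iff, eqB_iff] at h
    obtain ⟨z, hz⟩ : ∃ z : ℤ, Encodable.encode z = c.unpair.1 :=
      ⟨Denumerable.ofNat ℤ c.unpair.1, Denumerable.encode_ofNat _⟩
    rw [← hz, ← int_natAbs_code, ← coprime_test _ _ h.1] at h
    refine ⟨⟨z, c.unpair.2, by omega, h.2⟩, ?_⟩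
    rw [old_encode_rat]
    simp only [hz, Nat.pair_unpair]
  · rintro ⟨q, rfl⟩
    rw [old_encode_rat]
    unfold ratCodeB
    rw [Bool.and_eq_true, leB_iff, eqB_iff]
    simp only [Nat.unpair_pair]
    rw [← int_natAbs_code, ← coprime_test _ _ q.den_pos]
    exact ⟨q.den_pos, q.reduced⟩

theorem rat_code_computable : ∃ K : ℕ → ℕ, Computable K ∧
    ∀ n, K n = @Encodable.encode ℚ Rat.instEncodable (Denumerable.ofNat ℚ n) := by
  obtain ⟨K, hK, hs⟩ := ofNat_rat_zero_succ
  refine ⟨K, ?_, hK⟩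
  have hv : ∀ n, ratCodeB (K n) = true := fun n => (ratCodeB_iff _).2 ⟨_, (hK n).symm⟩
  have hex : ∀ c : ℕ, ∃ m, ratCodeB (c + m + 1) = true := by
    intro c
    have hm : StrictMono K := strictMono_nat_of_lt_succ fun n => (hs n).1
    have : c + 1 ≤ K (c+1) := hm.id_le _
    refine ⟨K (c+1) - c - 1, ?_⟩
    have h2 : c + (K (c+1) - c - 1) + 1 = K (c+1) := by omega
    rw [h2]; exact hv _
  obtain ⟨F, hF, hF2⟩ := cp_find (P := fun c m => ratCodeB (c + m + 1))
    (cp_ratCodeB.comp (by fun_prop)) hex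
  have h : Computable (fun n : ℕ => (Nat.rec (K 0) (fun _ s => s + F s + 1) n : ℕ)) := by
    refine Computable.nat_rec (f := fun n : ℕ => n) (by fun_prop) (cp_const _) (h := fun x p => p.2 + F p.2 + 1) ?_
    refine Computable₂.mk ?_
    fun_prop
  refine h.of_eq fun n => ?_
  induction n with
  | zero => rfl
  | succ n ih =>
    simp only [ih]
    apply le_antisymm
    · by_contra hlt
      push Not at hlt
      have := (hF2 (K n)).2 (K (n+1) - K n - 1) (by have := (hs n).1; omega)
      have h2 : K n + (K (n+1) - K n - 1) + 1 = K (n+1) := by have := (hs n).1; omega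
      rw [h2, hv] at this; simp at this
    · obtain ⟨q, hq⟩ := (ratCodeB_iff _).1 (hF2 (K n)).1
      rcases (hs n).2 q with h | h
      · rw [hq] at h; omega
      · rwa [hq] at h

theorem computableReal_nat {α : ℝ} (h0 : 0 ≤ α) (h : ComputableReal α) :
    ∃ g : ℕ → ℕ, Computable g ∧ ∀ n, |α - (g n : ℝ) / 2 ^ n| ≤ 2 / 2 ^ n := by
  obtain ⟨f, hf, hf2⟩ := h
  obtain ⟨K, hKc, hK⟩ := rat_code_computable
  have hK' : ∀ n, K (@Encodable.encode ℚ (Primcodable.ofDenumerable ℚ).toEncodable (f n)) = Nat.pair (Encodable.encode (f n).num) (f n).den := by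
    intro n
    rw [hK, ← old_encode_rat]
    congr 1
    exact Denumerable.ofNat_encode (f n)
  have he : Computable (fun n : ℕ => @Encodable.encode ℚ (Primcodable.ofDenumerable ℚ).toEncodable (f n)) := Computable.encode.comp hf
  have hnum : Computable (fun n : ℕ => (f n).num.toNat) := by
    refine Computable.of_eq (f := fun n => ((K (@Encodable.encode ℚ (Primcodable.ofDenumerable ℚ).toEncodable (f n))).unpair.1 / 2) *
      (1 - (K (@Encodable.encode ℚ (Primcodable.ofDenumerable ℚ).toEncodable (f n))).unpair.1 % 2)) (by fun_prop) fun n => ?_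
    rw [hK', Nat.unpair_pair, int_toNat_code]
  have hden : Computable (fun n : ℕ => (f n).den) := by
    refine Computable.of_eq (f := fun n => (K (@Encodable.encode ℚ (Primcodable.ofDenumerable ℚ).toEncodable (f n))).unpair.2) (by fun_prop)
      fun n => ?_
    rw [hK', Nat.unpair_pair]
  refine ⟨fun n => (f (2 ^ n)).num.toNat * 2 ^ n / (f (2 ^ n)).den, ?_, fun n => ?_⟩
  · have hp : Computable (fun n : ℕ => 2 ^ n) := by fun_prop
    exact cp_div (cp_mul (hnum.comp hp) hp) (hden.comp hp)
  · have h1 := hf2 (2 ^ n) (by positivity)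
    set q := f (2 ^ n)
    have hd : (0 : ℝ) < q.den := by exact_mod_cast q.den_pos
    have h2 : |α - (q.num.toNat : ℝ) / q.den| ≤ 1 / 2 ^ n := by
      have hq : (q : ℝ) = (q.num : ℝ) / q.den := by exact_mod_cast (Rat.num_div_den q).symm
      push_cast at h1
      rcases le_total 0 q.num with hn | hn
      · have : (q.num.toNat : ℝ) = (q.num : ℝ) := by exact_mod_cast Int.toNat_of_nonneg hn
        rw [this, ← hq]; exact h1.le
      · rw [Int.toNat_of_nonpos hn]
        have hq0 : (q : ℝ) ≤ 0 := by
          rw [hq]; exact div_nonpos_of_nonpos_of_nonneg (by exact_mod_cast hn) hd.le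
        rw [abs_lt] at h1
        simp only [Nat.cast_zero, zero_div, sub_zero]
        rw [abs_of_nonneg h0]; linarith
    have h3 : |(q.num.toNat : ℝ) / q.den - ((q.num.toNat * 2 ^ n / q.den : ℕ) : ℝ) / 2 ^ n| ≤ 1 / 2 ^ n := by
      have hp : (0 : ℝ) < 2 ^ n := by positivity
      have e1 : ((q.num.toNat * 2 ^ n / q.den : ℕ) : ℝ) ≤ (q.num.toNat : ℝ) / q.den * 2 ^ n := by
        refine (Nat.cast_div_le).trans (le_of_eq ?_)
        push_cast; ring
      have e2 : (q.num.toNat : ℝ) / q.den * 2 ^ n ≤ ((q.num.toNat * 2 ^ n / q.den : ℕ) : ℝ) + 1 := by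
        have := Nat.lt_div_mul_add (a := q.num.toNat * 2 ^ n) q.den_pos
        have h' : ((q.num.toNat * 2 ^ n : ℕ) : ℝ) ≤ ((q.num.toNat * 2 ^ n / q.den : ℕ) : ℝ) * q.den + q.den := by
          exact_mod_cast this.le
        push_cast at h'
        rw [div_mul_eq_mul_div, div_le_iff₀ hd]
        push_cast
        linarith
      rw [abs_le]
      constructor
      · have e3 := (div_le_iff₀ hp).2 e1
        have e4 : (0 : ℝ) < 1 / 2 ^ n := by positivity
        linarith
      · rw [sub_le_iff_le_add, ← add_div, le_div_iff₀ hp]; linarith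
    calc _ ≤ _ := abs_sub_le α ((q.num.toNat : ℝ) / q.den) _
      _ ≤ 1 / 2 ^ n + 1 / 2 ^ n := add_le_add h2 h3
      _ = _ := by ring

theorem exists_stage (V : Computer) : ∃ E : ℕ → List Bool → Option (List Bool),
    Computable (fun x : ℕ × List Bool => E x.1 x.2) ∧ (∀ p, E 0 p = none) ∧
    (∀ t t' p w, t ≤ t' → E t p = some w → E t' p = some w) ∧
    (∀ p w, w ∈ V.f p ↔ ∃ t, E t p = some w) := by
  obtain ⟨c, hc⟩ := Nat.Partrec.Code.exists_code.1 V.partrec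
  have hev : ∀ p, Nat.Partrec.Code.eval c (Encodable.encode p) = (V.f p).map Encodable.encode := by
    intro p; rw [hc]; simp
  refine ⟨fun t p => (Nat.Partrec.Code.evaln t c (Encodable.encode p)).bind Encodable.decode,
    ?_, ?_, ?_, ?_⟩
  · refine Computable.option_bind (Nat.Partrec.Code.primrec_evaln.to_comp.comp
      (((Computable.fst).pair (Computable.const c)).pair (Computable.encode.comp Computable.snd))) ?_
    exact Computable.decode.comp Computable.snd
  · intro p; simp [Nat.Partrec.Code.evaln]
  · intro t t' p w htt h
    obtain ⟨e, he, hw⟩ := Option.bind_eq_some_iff.1 h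
    exact Option.bind_eq_some_iff.2 ⟨e, Nat.Partrec.Code.evaln_mono htt he, hw⟩
  · intro p w
    constructor
    · intro h
      have h1 : Encodable.encode w ∈ Nat.Partrec.Code.eval c (Encodable.encode p) := by
        rw [hev]; exact Part.mem_map _ h
      obtain ⟨t, ht⟩ := Nat.Partrec.Code.evaln_complete.1 h1
      exact ⟨t, Option.bind_eq_some_iff.2 ⟨_, ht, Encodable.encodek w⟩⟩
    · rintro ⟨t, ht⟩
      obtain ⟨e, he, hw⟩ := Option.bind_eq_some_iff.1 ht
      have h1 := Nat.Partrec.Code.evaln_sound he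
      rw [hev] at h1
      obtain ⟨w', hw', rfl⟩ := (Part.mem_map_iff _).1 h1
      rw [Encodable.encodek] at hw
      cases hw; exact hw'

theorem exists_enum (V : Computer) : ∃ A : ℕ → Option (List Bool × List Bool),
    Computable A ∧ (∀ p w, w ∈ V.f p ↔ ∃ k, A k = some (p, w)) ∧
    ∀ k k' p w w', A k = some (p, w) → A k' = some (p, w') → k = k' := by
  obtain ⟨E, hE, h0, hm, hV⟩ := exists_stage V
  let A : ℕ → Option (List Bool × List Bool) := fun k =>
    (Encodable.decode k.unpair.2 : Option (List Bool)).bind fun p =>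
      bif eqB (Encodable.encode p) k.unpair.2 && eqB (E k.unpair.1 p) none then
        (E (k.unpair.1 + 1) p).map fun w => (p, w) else none
  have hA : ∀ k p w, A k = some (p, w) ↔ Encodable.encode p = k.unpair.2 ∧
      E k.unpair.1 p = none ∧ E (k.unpair.1 + 1) p = some w := by
    intro k p w
    simp only [A, Option.bind_eq_some_iff]
    constructor
    · rintro ⟨p', hp', h⟩
      cases hb : (eqB (Encodable.encode p') k.unpair.2 && eqB (E k.unpair.1 p') none) with
      | false => rw [hb] at h; simp at h
      | true =>
        rw [hb] at h
        rw [Bool.and_eq_true, eqB_iff, eqB_iff] at hb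
        simp only [cond_true, Option.map_eq_some_iff, Prod.mk.injEq] at h
        obtain ⟨w', h1, rfl, rfl⟩ := h
        exact ⟨hb.1, hb.2, h1⟩
    · rintro ⟨h1, h2, h3⟩
      refine ⟨p, by rw [← h1, Encodable.encodek], ?_⟩
      have hb : (eqB (Encodable.encode p) k.unpair.2 && eqB (E k.unpair.1 p) none) = true := by
        rw [Bool.and_eq_true, eqB_iff, eqB_iff]; exact ⟨h1, h2⟩
      rw [hb, h3]; rfl
  refine ⟨A, ?_, ?_, ?_⟩
  · refine Computable.option_bind (Computable.decode.comp (by fun_prop)) ?_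
    refine Computable₂.mk ?_
    have e1 : Computable (fun x : ℕ × List Bool => E x.1.unpair.1 x.2) :=
      hE.comp (g := fun x : ℕ × List Bool => (x.1.unpair.1, x.2)) (by fun_prop)
    have e2 : Computable (fun x : ℕ × List Bool => E (x.1.unpair.1 + 1) x.2) :=
      hE.comp (g := fun x : ℕ × List Bool => (x.1.unpair.1 + 1, x.2)) (by fun_prop)
    refine cp_cond (cp_and (cp_eq (Computable.encode.comp Computable.snd) (by fun_prop))
      (cp_eq e1 (by fun_prop))) (Computable.option_map e2 ?_) (by fun_prop)
    refine Computable₂.mk ?_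
    fun_prop
  · intro p w
    rw [hV]
    constructor
    · intro h
      classical
      have hs := Nat.find_spec h
      have hmin := fun m => Nat.find_min (m := m) h
      generalize Nat.find h = t at hs hmin
      cases t with
      | zero => rw [h0] at hs; simp at hs
      | succ t =>
        refine ⟨Nat.pair t (Encodable.encode p), (hA _ _ _).2 ?_⟩
        simp only [Nat.unpair_pair, true_and]
        refine ⟨?_, hs⟩
        cases hh : E t p with
        | none => rfl
        | some w' =>
          have := hm t (t+1) p w' (Nat.le_succ t) hh
          rw [hs] at this
          cases this
          exact absurd hh (hmin t (Nat.lt_succ_self t))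
    · rintro ⟨k, hk⟩
      exact ⟨_, ((hA _ _ _).1 hk).2.2⟩
  · intro k k' p w w' h h'
    rw [hA] at h h'
    have key : ∀ a b w w', E a p = none → E (b+1) p = some w → E (a+1) p = some w' → a ≤ b := by
      intro a b w w' ha hb _
      by_contra hlt
      have := hm (b+1) a p w (by omega) hb
      rw [ha] at this; simp at this
    have e1 : k.unpair.1 = k'.unpair.1 :=
      le_antisymm (key _ _ _ _ h.2.1 h'.2.2 h.2.2) (key _ _ _ _ h'.2.1 h.2.2 h'.2.2)
    rw [← Nat.pair_unpair k, ← Nat.pair_unpair k', e1, ← h.1, ← h'.1]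

theorem complexity_le {C : Computer} {s p : List Bool} (h : s ∈ C.f p) :
    complexity C s ≤ p.length := Nat.sInf_le ⟨p, h, rfl⟩

theorem optimal_le {U : Computer} (hU : Optimal U) (C : Computer) :
    ∃ d : ℕ, ∀ s p, s ∈ C.f p → complexity U s ≤ p.length + d := by
  obtain ⟨d, hd⟩ := hU C
  refine ⟨d, fun s p h => ?_⟩
  obtain ⟨q, hq, hl⟩ := hd p (Part.dom_iff_mem.2 ⟨s, h⟩)
  exact (complexity_le (hq ▸ h)).trans hl

theorem optimal_attained {U : Computer} (hU : Optimal U) (s : List Bool) :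
    ∃ p, s ∈ U.f p ∧ p.length = complexity U s := by
  have hmem : ∀ p : List Bool, (bif eqB p ([] : List Bool) then Part.some s else Part.none).Dom ↔ p = [] := by
    intro p
    cases p with
    | nil => simp [eqB]
    | cons a l => simp [eqB]
  let C : Computer :=
    { f := fun p => bif eqB p ([] : List Bool) then Part.some s else Part.none
      partrec := Partrec.cond (by fun_prop) (Computable.const s).partrec Partrec.none
      dom_nonempty := ⟨[], (hmem []).2 rfl⟩
      dom_prefixFree := by
        intro p hp q hq _
        rw [(hmem p).1 hp, (hmem q).1 hq] }
  obtain ⟨d, hd⟩ := hU C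
  obtain ⟨q, hq, _⟩ := hd [] ((hmem []).2 rfl)
  have h1 : s ∈ U.f q := by
    rw [hq]; simp [C, eqB]
  exact Nat.sInf_mem (s := {n | ∃ p : List Bool, s ∈ U.f p ∧ p.length = n}) ⟨_, q, h1, rfl⟩

/-- Building a computer from a prefix-free computable coding of inputs. -/
theorem exists_computer {X : Type} [Primcodable X] {E : X → List Bool} (hE : Computable E)
    {R : X → Bool} (hR : Computable R)
    (hpf : ∀ x y, R x = true → R y = true → E x <+: E y → x = y)
    {G : X →. List Bool} (hG : Partrec G) (hne : ∃ x, R x = true ∧ (G x).Dom) :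
    ∃ C : Computer, ∀ x s, R x = true → s ∈ G x → s ∈ C.f (E x) := by
  let D : List Bool → ℕ → Option X := fun p k =>
    (Encodable.decode k : Option X).bind fun x =>
      bif R x && eqB (E x) p then some x else none
  have hD : ∀ p k x, x ∈ D p k → R x = true ∧ E x = p := by
    intro p k x h
    obtain ⟨x', _, h⟩ := Option.bind_eq_some_iff.1 h
    cases hb : (R x' && eqB (E x') p) with
    | false => rw [hb] at h; simp at h
    | true =>
      rw [hb] at h
      simp only [cond_true, Option.some.injEq] at h
      subst h
      rwa [Bool.and_eq_true, eqB_iff] at hb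
  have hDc : Computable₂ D := by
    refine Computable.option_bind (Computable.decode.comp Computable.snd) ?_
    refine Computable₂.mk ?_
    refine cp_cond ?_ (Computable.option_some.comp Computable.snd) (by fun_prop)
    exact cp_and (hR.comp Computable.snd) (cp_eq (hE.comp Computable.snd) (by fun_prop))
  have hf : ∀ p x, x ∈ Nat.rfindOpt (D p) → R x = true ∧ E x = p := by
    intro p x h
    obtain ⟨k, hk⟩ := Nat.rfindOpt_spec h
    exact hD p k x hk
  have hf2 : ∀ x, R x = true → x ∈ Nat.rfindOpt (D (E x)) := by
    intro x hx
    have hdom : (Nat.rfindOpt (D (E x))).Dom := by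
      refine Nat.rfindOpt_dom.2 ⟨Encodable.encode x, x, ?_⟩
      have hb : (R x && eqB (E x) (E x)) = true := by rw [Bool.and_eq_true, eqB_iff]; exact ⟨hx, rfl⟩
      simp [D, hb]
    obtain ⟨y, hy⟩ := Part.dom_iff_mem.1 hdom
    obtain ⟨h1, h2⟩ := hf _ _ hy
    have : y = x := hpf y x h1 hx (h2 ▸ List.prefix_refl _)
    exact this ▸ hy
  refine ⟨{ f := fun p => (Nat.rfindOpt (D p)).bind G
            partrec := (Partrec.rfindOpt hDc).bind (hG.comp Computable.snd)
            dom_nonempty := ?_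
            dom_prefixFree := ?_ }, ?_⟩
  · obtain ⟨x, hx, hgx⟩ := hne
    obtain ⟨s, hs⟩ := Part.dom_iff_mem.1 hgx
    exact ⟨E x, Part.dom_iff_mem.2 ⟨s, Part.mem_bind (hf2 x hx) hs⟩⟩
  · intro p hp q hq hpq
    obtain ⟨s, hs⟩ := Part.dom_iff_mem.1 hp
    obtain ⟨s', hs'⟩ := Part.dom_iff_mem.1 hq
    obtain ⟨x, hx, _⟩ := Part.mem_bind_iff.1 hs
    obtain ⟨y, hy, _⟩ := Part.mem_bind_iff.1 hs'
    obtain ⟨h1, rfl⟩ := hf _ _ hx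
    obtain ⟨h2, rfl⟩ := hf _ _ hy
    rw [hpf x y h1 h2 hpq]
  · intro x s hx hs
    exact Part.mem_bind (hf2 x hx) hs

theorem PrefixFree.uniquelyDecodable {S : Set (List Bool)} (h : PrefixFree S) (h0 : [] ∉ S) :
    InformationTheory.UniquelyDecodable S := by
  intro L₁
  induction L₁ with
  | nil =>
    intro L₂ _ h2 he
    cases L₂ with
    | nil => rfl
    | cons a l =>
      simp at he
      exact absurd (h2 a (by simp)) (he.1 ▸ h0)
  | cons a l ih =>
    intro L₂ h1 h2 he
    cases L₂ with
    | nil =>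
      simp at he
      exact absurd (h1 a (by simp)) (he.1 ▸ h0)
    | cons b m =>
      have hab : a = b := by
        simp only [List.flatten_cons] at he
        have ha := h1 a (by simp)
        have hb := h2 b (by simp)
        have p1 : a <+: b ++ m.flatten := ⟨_, he⟩
        have p2 : b <+: b ++ m.flatten := List.prefix_append _ _
        rcases List.prefix_or_prefix_of_prefix p1 p2 with h' | h'
        · exact h a ha b hb h'
        · exact (h b hb a ha h').symm
      subst hab
      rw [List.flatten_cons, List.flatten_cons, List.append_cancel_left_eq] at he
      rw [ih m (fun w hw => h1 w (by simp [hw])) (fun w hw => h2 w (by simp [hw])) he]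

theorem kraft {S : Finset (List Bool)} (h : PrefixFree (S : Set (List Bool))) :
    ∑ p ∈ S, (1 / 2 : ℝ) ^ p.length ≤ 1 := by
  by_cases h0 : [] ∈ S
  · have : S = {[]} := by
      ext p
      simp only [Finset.mem_singleton]
      exact ⟨fun hp => (h [] h0 p hp List.nil_prefix).symm, fun hp => hp ▸ h0⟩
    rw [this]; simp
  · have := InformationTheory.kraft_mcmillan_inequality (h.uniquelyDecodable (by simpa using h0))
    simpa using this

/-- Repetition-free enumeration of the graph of a computer. -/
structure IsEnum (V : Computer) (A : ℕ → Option (List Bool × List Bool)) : Prop where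
  comp : Computable A
  mem : ∀ p w, w ∈ V.f p ↔ ∃ k, A k = some (p, w)
  inj : ∀ k kb p w wb, A k = some (p, w) → A kb = some (p, wb) → k = kb

/-- The `k`-th term. -/
noncomputable def tm (A : ℕ → Option (List Bool × List Bool)) (x : ℝ) (k : ℕ) : ℝ :=
  match A k with
  | none => 0
  | some a => x ^ a.1.length

/-- Partial sums. -/
noncomputable def ps (A : ℕ → Option (List Bool × List Bool)) (x : ℝ) (s : ℕ) : ℝ :=
  ∑ k ∈ Finset.range s, tm A x k

theorem tm_some {A : ℕ → Option (List Bool × List Bool)} {k p w} (h : A k = some (p, w)) (x : ℝ) :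
    tm A x k = x ^ p.length := by simp [tm, h]

theorem tm_none {A : ℕ → Option (List Bool × List Bool)} {k} (h : A k = none) (x : ℝ) :
    tm A x k = 0 := by simp [tm, h]

theorem tm_nonneg (A : ℕ → Option (List Bool × List Bool)) {x : ℝ} (hx : 0 ≤ x) (k : ℕ) :
    0 ≤ tm A x k := by
  unfold tm; split <;> positivity

theorem ps_eq {V A} (hA : IsEnum V A) (s : ℕ) : ∃ S : Finset (List Bool),
    (∀ p, p ∈ S ↔ ∃ k < s, ∃ w, A k = some (p, w)) ∧
    ∀ x : ℝ, ps A x s = ∑ p ∈ S, x ^ p.length := by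
  induction s with
  | zero => exact ⟨∅, by simp, by simp [ps]⟩
  | succ s ih =>
    obtain ⟨S, h1, h2⟩ := ih
    cases h : A s with
    | none =>
      refine ⟨S, fun p => ?_, fun x => ?_⟩
      · rw [h1]
        constructor
        · rintro ⟨k, hk, h⟩; exact ⟨k, by omega, h⟩
        · rintro ⟨k, hk, w, hw⟩
          refine ⟨k, ?_, w, hw⟩
          rcases Nat.lt_succ_iff_lt_or_eq.1 hk with hk | rfl
          · exact hk
          · rw [h] at hw; simp at hw
      · rw [← h2, ps, Finset.sum_range_succ, tm_none h, add_zero, ps]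
    | some a =>
      obtain ⟨q, v⟩ := a
      have hq : q ∉ S := by
        intro hq
        obtain ⟨k, hk, w, hw⟩ := (h1 q).1 hq
        have := hA.inj _ _ _ _ _ hw h
        omega
      refine ⟨insert q S, fun p => ?_, fun x => ?_⟩
      · rw [Finset.mem_insert, h1]
        constructor
        · rintro (rfl | ⟨k, hk, h⟩)
          · exact ⟨s, by omega, v, h⟩
          · exact ⟨k, by omega, h⟩
        · rintro ⟨k, hk, w, hw⟩
          rcases Nat.lt_succ_iff_lt_or_eq.1 hk with hk | rfl
          · exact Or.inr ⟨k, hk, w, hw⟩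
          · rw [h] at hw; simp at hw; exact Or.inl hw.1.symm
      · rw [Finset.sum_insert hq, ← h2, ps, Finset.sum_range_succ, tm_some h, add_comm, ps]

theorem kraft_dom {V : Computer} {S : Finset (List Bool)} (hS : ∀ p ∈ S, p ∈ V.f.Dom) :
    ∑ p ∈ S, (1 / 2 : ℝ) ^ p.length ≤ 1 :=
  kraft fun p hp q hq h => V.dom_prefixFree p (hS p hp) q (hS q hq) h

theorem ps_half_le {V A} (hA : IsEnum V A) (s : ℕ) : ps A (1 / 2) s ≤ 1 := by
  obtain ⟨S, h1, h2⟩ := ps_eq hA s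
  rw [h2]
  refine kraft_dom (V := V) fun p hp => ?_
  obtain ⟨k, _, w, hw⟩ := (h1 p).1 hp
  exact Part.dom_iff_mem.2 ⟨w, (hA.mem p w).2 ⟨k, hw⟩⟩

theorem hasSum_Z {V A} (hA : IsEnum V A) {T : ℝ} (h0 : 0 < T) (h1 : T ≤ 1) :
    HasSum (tm A ((2 : ℝ) ^ (-1 / T))) (Zfun V T) := by
  set β := (2 : ℝ) ^ (-1 / T) with hβ
  have hβ0 : 0 < β := by positivity
  have hβ1 : β ≤ 1 / 2 := by
    have : (1 / 2 : ℝ) = (2 : ℝ) ^ (-1 : ℝ) := by rw [Real.rpow_neg_one]; norm_num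
    rw [this]
    apply Real.rpow_le_rpow_of_exponent_le (by norm_num)
    rw [div_le_iff₀ h0]; linarith
  have hb : ∀ p : List Bool, boltzmann T p = β ^ p.length := by
    intro p
    rw [boltzmann, hβ, ← Real.rpow_mul_natCast (by norm_num)]
    congr 1; ring
  have hs : Summable (fun p : V.f.Dom => β ^ p.1.length) := by
    refine summable_of_sum_le (c := 1) (fun p => by positivity) fun u => ?_
    calc ∑ p ∈ u, β ^ p.1.length ≤ ∑ p ∈ u, (1 / 2 : ℝ) ^ p.1.length := by gcongr
      _ = ∑ p ∈ u.map (Function.Embedding.subtype _), (1 / 2 : ℝ) ^ p.length := by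
        rw [Finset.sum_map]; rfl
      _ ≤ 1 := by
        refine kraft_dom (V := V) fun p hp => ?_
        obtain ⟨q, _, rfl⟩ := Finset.mem_map.1 hp
        exact q.2
  have hex : ∀ p : V.f.Dom, ∃ k w, A k = some (p.1, w) := by
    intro p
    obtain ⟨w, hw⟩ := Part.dom_iff_mem.1 p.2
    obtain ⟨k, hk⟩ := (hA.mem _ _).1 hw
    exact ⟨k, w, hk⟩
  choose i w hi using hex
  have hinj : Function.Injective i := by
    intro p q h
    have e1 := hi p
    rw [h, hi q] at e1
    simp at e1
    exact Subtype.ext e1.1.symm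
  have hsum : HasSum (tm A β ∘ i) (Zfun V T) := by
    have : (tm A β ∘ i) = fun p : V.f.Dom => β ^ p.1.length := by
      funext p; exact tm_some (hi p) β
    rw [this]
    unfold Zfun
    simp only [hb]
    exact hs.hasSum
  refine (hinj.hasSum_iff ?_).1 hsum
  intro k hk
  cases h : A k with
  | none => exact tm_none h β
  | some a =>
    exfalso
    apply hk
    have hd : a.1 ∈ V.f.Dom := Part.dom_iff_mem.2 ⟨a.2, (hA.mem _ _).2 ⟨k, h⟩⟩
    exact ⟨⟨a.1, hd⟩, hA.inj _ _ _ _ _ (hi ⟨a.1, hd⟩) h⟩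

/-- Value of a natural-valued function on an enumeration step, zero if the step is empty. -/
def stepVal (A : ℕ → Option (List Bool × List Bool)) (f : List Bool × List Bool → ℕ) (k : ℕ) : ℕ :=
  ((A k).map f).getD 0

theorem cp_stepVal {A : ℕ → Option (List Bool × List Bool)} (hA : Computable A)
    {f : List Bool × List Bool → ℕ} (hf : Computable f) : Computable (stepVal A f) := by
  refine Computable.option_getD (Computable.option_map hA ?_) (by fun_prop)
  exact hf.comp Computable.snd

theorem exists_geB {A : ℕ → Option (List Bool × List Bool)} (hA : Computable A) :
    ∃ B : ℕ × ℕ × ℕ × ℕ × ℕ → Bool, Computable B ∧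
      ∀ s q n r m, B (s, q, n, r, m) = true ↔ (r : ℝ) / 2 ^ m ≤ ps A ((q : ℝ) / 2 ^ n) s := by
  set ln := stepVal A (fun a => a.1.length) with hln
  set ind := stepVal A (fun _ => 1) with hind
  have cln : Computable ln := cp_stepVal hA (Computable.list_length.comp Computable.fst)
  have cind : Computable ind := cp_stepVal hA (by fun_prop)
  set Lf : ℕ → ℕ := fun s => ∑ k ∈ Finset.range s, ln k with hLf
  have cL : Computable Lf := cp_sum (f := fun _ k => ln k) (by fun_prop) (by fun_prop)
  set N : ℕ × ℕ × ℕ → ℕ := fun x => ∑ k ∈ Finset.range x.1,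
    ind k * (x.2.1 ^ ln k * 2 ^ (x.2.2 * (Lf x.1 - ln k))) with hN
  have cN : Computable N := by
    refine cp_sum (f := fun (x : ℕ × ℕ × ℕ) k => ind k * (x.2.1 ^ ln k * 2 ^ (x.2.2 * (Lf x.1 - ln k)))) ?_ (by fun_prop)
    fun_prop
  have key : ∀ s q n : ℕ, ps A ((q : ℝ) / 2 ^ n) s = (N (s, q, n) : ℝ) / 2 ^ (n * Lf s) := by
    intro s q n
    simp only [hN, ps]
    push_cast
    rw [Finset.sum_div]
    refine Finset.sum_congr rfl fun k hk => ?_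
    have hle : ln k ≤ Lf s := Finset.single_le_sum (f := ln) (fun _ _ => Nat.zero_le _) hk
    cases h : A k with
    | none => rw [tm_none h]; simp [hind, stepVal, h]
    | some a =>
      rw [tm_some (p := a.1) (w := a.2) h]
      have e1 : ind k = 1 := by simp [hind, stepVal, h]
      have e2 : ln k = a.1.length := by simp [hln, stepVal, h]
      rw [← e2, e1, div_pow, ← pow_mul]
      obtain ⟨d, hd⟩ := Nat.exists_eq_add_of_le hle
      rw [hd, Nat.add_sub_cancel_left, mul_add, pow_add]
      field_simp
      simp
  refine ⟨fun x => leB (x.2.2.2.1 * 2 ^ (x.2.2.1 * Lf x.1)) (N (x.1, x.2.1, x.2.2.1) * 2 ^ x.2.2.2.2), ?_, ?_⟩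
  · fun_prop
  · intro s q n r m
    rw [leB_iff, key, div_le_div_iff₀ (by positivity) (by positivity)]
    exact_mod_cast Iff.rfl

theorem exists_fresh {V A} (hA : IsEnum V A) : ∃ O : ℕ → List Bool, Computable O ∧
    ∀ s, ∀ k < s, ∀ p, A k ≠ some (p, O s) := by
  set ol := stepVal A (fun a => a.2.length) with hol
  have col : Computable ol := cp_stepVal hA.comp (Computable.list_length.comp Computable.snd)
  have cs : Computable (fun s : ℕ => (∑ k ∈ Finset.range s, ol k) + 1) :=
    cp_add (cp_sum (f := fun _ k => ol k) (by fun_prop) (by fun_prop)) (by fun_prop)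
  have cr : Computable (fun n : ℕ => (List.range n).map (fun _ => true)) :=
    (Primrec.list_map Primrec.list_range (Primrec.const true).to₂).to_comp
  refine ⟨fun s => (List.range ((∑ k ∈ Finset.range s, ol k) + 1)).map (fun _ => true),
    cr.comp cs, fun s k hk p h => ?_⟩
  have h1 : ol k ≤ ∑ k ∈ Finset.range s, ol k :=
    Finset.single_le_sum (f := ol) (fun _ _ => Nat.zero_le _) (by simpa using hk)
  have h2 : ol k = (∑ k ∈ Finset.range s, ol k) + 1 := by
    conv_lhs => rw [hol, stepVal, h]
    simp
  omega

theorem ps_upper {V A} (hA : IsEnum V A) {β b : ℝ} (h0 : 0 ≤ β) (h1 : β < 1 / 2) (h2 : β ≤ b)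
    (h3 : b ≤ 1 / 2) (s : ℕ) : ps A b s - ps A β s ≤ (b - β) / (1 / 2 - β) := by
  set c := (b - β) / (1 / 2 - β) with hc
  have hd : 0 < 1 / 2 - β := by linarith
  have hc0 : 0 ≤ c := div_nonneg (by linarith) hd.le
  have hc1 : c ≤ 1 := by rw [hc, div_le_one hd]; linarith
  have hb : b = (1 - c) * β + c * (1 / 2) := by
    have : c * (1 / 2 - β) = b - β := div_mul_cancel₀ _ hd.ne'
    linarith
  have hpow : ∀ l : ℕ, b ^ l - β ^ l ≤ c * (1 / 2) ^ l := by
    intro l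
    have := (convexOn_pow (𝕜 := ℝ) l).2 (Set.mem_Ici.2 h0) (Set.mem_Ici.2 (by norm_num : (0 : ℝ) ≤ 1 / 2))
      (by linarith : 0 ≤ 1 - c) hc0 (by ring)
    simp only [smul_eq_mul] at this
    rw [← hb] at this
    have h4 : 0 ≤ c * β ^ l := by positivity
    linarith
  calc ps A b s - ps A β s = ∑ k ∈ Finset.range s, (tm A b k - tm A β k) := by
        rw [Finset.sum_sub_distrib]; rfl
    _ ≤ ∑ k ∈ Finset.range s, c * tm A (1 / 2) k := by
        refine Finset.sum_le_sum fun k _ => ?_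
        unfold tm
        split
        · simp
        · exact hpow _
    _ = c * ps A (1 / 2) s := by rw [← Finset.mul_sum]; rfl
    _ ≤ c * 1 := by gcongr; exact ps_half_le hA s
    _ = c := mul_one c

theorem ps_lower {A : ℕ → Option (List Bool × List Bool)} {k0 p0 w0} (hk : A k0 = some (p0, w0))
    (hp : 1 ≤ p0.length) {β x y : ℝ} (h0 : 0 ≤ β) (hx : 0 ≤ x) (hxy : x ≤ y) (hy : β ≤ y) {s : ℕ}
    (hs : k0 < s) : β ^ (p0.length - 1) * (y - x) ≤ ps A y s - ps A x s := by
  have hterm : ∀ k, 0 ≤ tm A y k - tm A x k := by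
    intro k
    unfold tm
    split
    · simp
    · exact sub_nonneg.2 (by gcongr)
  have h1 : tm A y k0 - tm A x k0 ≤ ps A y s - ps A x s := by
    have : ps A y s - ps A x s = ∑ k ∈ Finset.range s, (tm A y k - tm A x k) := by
      rw [Finset.sum_sub_distrib]; rfl
    rw [this]
    exact Finset.single_le_sum (f := fun k => tm A y k - tm A x k) (fun k _ => hterm k) (by simpa using hs)
  refine le_trans ?_ h1
  rw [tm_some hk, tm_some hk]
  obtain ⟨l, hl⟩ := Nat.exists_eq_add_of_le' hp
  rw [hl, Nat.add_sub_cancel, pow_succ, pow_succ]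
  have e1 : β ^ l ≤ y ^ l := by gcongr
  have e2 : x ^ l ≤ y ^ l := by gcongr
  nlinarith [mul_le_mul_of_nonneg_right e1 (sub_nonneg.2 hxy), mul_le_mul_of_nonneg_right e2 hx]

theorem exists_long {V A} (hV : Optimal V) (hA : IsEnum V A) :
    ∃ k0 p0 w0, A k0 = some (p0, w0) ∧ 1 ≤ p0.length := by
  obtain ⟨p, hp, _⟩ := optimal_attained hV []
  obtain ⟨q, hq, _⟩ := optimal_attained hV [true]
  have key : ∃ p w, w ∈ V.f p ∧ 1 ≤ p.length := by
    by_cases h : p = []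
    · refine ⟨q, _, hq, ?_⟩
      by_contra hlt
      have hq0 : q = [] := by
        rw [← List.length_eq_zero_iff]; omega
      rw [h] at hp; rw [hq0] at hq
      have := Part.mem_unique hp hq
      simp at this
    · exact ⟨p, _, hp, List.length_pos_iff.2 h⟩
  obtain ⟨p, w, hw, hl⟩ := key
  obtain ⟨k, hk⟩ := (hA.mem _ _).1 hw
  exact ⟨k, p, w, hk, hl⟩

theorem hasSum_Om {V A} (hA : IsEnum V A) : HasSum (tm A (1 / 2)) (Zfun V 1) := by
  have := hasSum_Z hA one_pos le_rfl
  have h2 : (2 : ℝ) ^ (-1 / 1 : ℝ) = 1 / 2 := by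
    rw [div_one, Real.rpow_neg_one]; norm_num
  rwa [h2] at this

theorem tail_bound {V A} (hA : IsEnum V A) {T : ℝ} (h0 : 0 < T) (h1 : T ≤ 1) {s m n : ℕ}
    (hm : T * n ≤ m) (hs : Zfun V 1 - ps A (1 / 2) s ≤ 1 / 2 ^ m) :
    Zfun V T - ps A ((2 : ℝ) ^ (-1 / T)) s ≤ 1 / 2 ^ n := by
  set δ : ℝ := 1 / 2 ^ m with hδ
  have hδ0 : 0 < δ := by positivity
  have hO := (hasSum_nat_add_iff' s).2 (hasSum_Om hA)
  have hZ := (hasSum_nat_add_iff' s).2 (hasSum_Z hA h0 h1)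
  have hT1 : 0 ≤ 1 / T - 1 := by
    rw [sub_nonneg, le_div_iff₀ h0]; linarith
  have hle : ∀ k, tm A (1 / 2) (k + s) ≤ δ := fun k =>
    (le_hasSum hO k (fun j _ => tm_nonneg A (by norm_num) _)).trans hs
  have hterm : ∀ k, tm A ((2 : ℝ) ^ (-1 / T)) (k + s) ≤ tm A (1 / 2) (k + s) * δ ^ (1 / T - 1) := by
    intro k
    have h2 := hle k
    cases h : A (k + s) with
    | none => rw [tm_none h, tm_none h]; simp
    | some a =>
      rw [tm_some (p := a.1) (w := a.2) h] at h2
      rw [tm_some (p := a.1) (w := a.2) h, tm_some (p := a.1) (w := a.2) h]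
      set y : ℝ := (1 / 2) ^ a.1.length with hy
      have hy0 : 0 < y := by positivity
      have e1 : ((2 : ℝ) ^ (-1 / T)) ^ a.1.length = y ^ (1 / T) := by
        have h3 : (1 / 2 : ℝ) = (2 : ℝ) ^ (-1 : ℝ) := by rw [Real.rpow_neg_one]; norm_num
        rw [hy, h3, ← Real.rpow_mul_natCast (by norm_num), ← Real.rpow_mul_natCast (by norm_num),
          ← Real.rpow_mul (by norm_num)]
        congr 1; ring
      have e2 : y ^ (1 / T) = y * y ^ (1 / T - 1) := by
        rw [Real.rpow_sub_one hy0.ne']; field_simp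
      rw [e1, e2]
      gcongr
  have h3 := hasSum_le hterm hZ (hO.mul_right _)
  calc Zfun V T - ps A ((2 : ℝ) ^ (-1 / T)) s ≤ _ := h3
    _ ≤ δ * δ ^ (1 / T - 1) := by
      have : Zfun V 1 - ∑ i ∈ Finset.range s, tm A (1 / 2) i ≤ δ := hs
      gcongr
    _ = δ ^ (1 / T) := by rw [Real.rpow_sub_one hδ0.ne']; field_simp
    _ = (2 : ℝ) ^ (-(m / T)) := by
      rw [hδ, one_div, ← Real.rpow_natCast, ← Real.rpow_neg (by norm_num), ← Real.rpow_mul (by norm_num)]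
      congr 1; ring
    _ ≤ (2 : ℝ) ^ (-(n : ℝ)) := by
      apply Real.rpow_le_rpow_of_exponent_le (by norm_num)
      rw [neg_le_neg_iff, le_div_iff₀ h0]; linarith
    _ = 1 / 2 ^ n := by rw [Real.rpow_neg (by norm_num), Real.rpow_natCast, one_div]

theorem phi_exp (t : ℝ) : (2:ℝ) ^ (-1 / t) = Real.exp (-(Real.log 2 / t)) := by
  rw [Real.rpow_def_of_pos (by norm_num)]
  congr 1; ring

theorem phi_pos (t : ℝ) : 0 < (2:ℝ) ^ (-1 / t) := by positivity

theorem phi_mono {s t : ℝ} (hs : 0 < s) (h : s ≤ t) : (2:ℝ) ^ (-1 / s) ≤ (2:ℝ) ^ (-1 / t) := by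
  apply Real.rpow_le_rpow_of_exponent_le (by norm_num)
  rw [neg_div, neg_div]
  exact neg_le_neg (one_div_le_one_div_of_le hs h)

theorem phi_lt_half {T : ℝ} (h0 : 0 < T) (h1 : T < 1) : (2:ℝ) ^ (-1 / T) < 1 / 2 := by
  have : (1/2:ℝ) = (2:ℝ) ^ (-1 : ℝ) := by
    rw [Real.rpow_neg_one]; norm_num
  rw [this]
  apply Real.rpow_lt_rpow_of_exponent_lt (by norm_num)
  rw [neg_div]
  exact neg_lt_neg (one_lt_one_div h0 h1)

theorem phi_upper {T t : ℝ} (h0 : 0 < T) (h : T ≤ t) :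
    (2:ℝ) ^ (-1 / t) - (2:ℝ) ^ (-1 / T) ≤ (t - T) / T ^ 2 := by
  have ht : 0 < t := by linarith
  rw [phi_exp, phi_exp]
  have l0 : 0 < Real.log 2 := Real.log_pos (by norm_num)
  have l1 : Real.log 2 < 1 := by linarith [Real.log_two_lt_d9]
  set x := Real.log 2 / t
  set y := Real.log 2 / T
  have hx : 0 < x := by positivity
  have e1 : Real.exp (-y) = Real.exp (-x) * Real.exp (-(y - x)) := by
    rw [← Real.exp_add]; congr 1; ring
  have e2 : Real.exp (-x) ≤ 1 := Real.exp_le_one_iff.2 (by linarith)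
  have e3 := Real.add_one_le_exp (-(y - x))
  have e4 : 0 < Real.exp (-x) := Real.exp_pos _
  have e5 : y - x ≤ (t - T) / T ^ 2 := by
    have : y - x = Real.log 2 * ((t - T) / (t * T)) := by
      simp only [x, y]; field_simp
    rw [this]
    have a1 : (t - T) / (t * T) ≤ (t - T) / T ^ 2 := by
      apply div_le_div_of_nonneg_left (by linarith) (by positivity)
      nlinarith
    have a0 : 0 ≤ (t - T) / (t * T) := div_nonneg (by linarith) (by positivity)
    nlinarith
  have e6 : 0 ≤ y - x := by
    simp only [x, y]
    rw [sub_nonneg]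
    exact div_le_div_of_nonneg_left l0.le h0 h
  rw [e1]
  nlinarith

theorem phi_gap {s t : ℝ} (hs : 0 < s) (h : s ≤ t) (hst : s * t ≤ 1) :
    (t - s) / 2 ≤ Real.log 2 / s - Real.log 2 / t := by
  have ht : 0 < t := by linarith
  have l0 : (1/2 : ℝ) ≤ Real.log 2 := by linarith [Real.log_two_gt_d9]
  have : Real.log 2 / s - Real.log 2 / t = Real.log 2 * ((t - s) / (s * t)) := by
    field_simp
  rw [this]
  have a1 : (t - s) ≤ (t - s) / (s * t) := by
    rw [le_div_iff₀ (by positivity)]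
    nlinarith
  nlinarith

theorem phi_lower_up {T t : ℝ} (h0 : 0 < T) (h : T ≤ t) (hst : T * t ≤ 1) :
    (2:ℝ) ^ (-1 / T) * ((t - T) / 3) ≤ (2:ℝ) ^ (-1 / t) - (2:ℝ) ^ (-1 / T) := by
  have hg := phi_gap h0 h hst
  rw [phi_exp, phi_exp]
  set y := Real.log 2 / t
  set x := Real.log 2 / T
  have e1 : Real.exp (-y) = Real.exp (-x) * Real.exp (x - y) := by
    rw [← Real.exp_add]; congr 1; ring
  have e3 := Real.add_one_le_exp (x - y)
  have e4 : 0 < Real.exp (-x) := Real.exp_pos _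
  rw [e1]
  nlinarith

theorem phi_lower_down {T t : ℝ} (h0 : 0 < t) (h : t ≤ T) (hT : T ≤ 1) :
    (2:ℝ) ^ (-1 / T) * ((T - t) / 3) ≤ (2:ℝ) ^ (-1 / T) - (2:ℝ) ^ (-1 / t) := by
  have hg := phi_gap h0 h (by nlinarith)
  rw [phi_exp, phi_exp]
  set y := Real.log 2 / t
  set x := Real.log 2 / T
  have e1 : Real.exp (-y) = Real.exp (-x) * Real.exp (-(y - x)) := by
    rw [← Real.exp_add]; congr 1; ring
  have e3 := Real.add_one_le_exp (y - x)
  have e4 : 0 < Real.exp (-x) := Real.exp_pos _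
  have e5 : Real.exp (-(y - x)) ≤ 1 - (T - t) / 3 := by
    rw [Real.exp_neg]
    rw [inv_le_iff_one_le_mul₀ (Real.exp_pos _)]
    nlinarith
  rw [e1]
  nlinarith

theorem exists_Q : ∃ Q : ℕ × ℕ → ℕ, Computable Q ∧
    (∀ a n : ℕ, 1 ≤ a → (2:ℝ) ^ (-1 / ((a:ℝ) / 2 ^ n)) ≤ (Q (a, n) : ℝ) / 2 ^ n ∧
      (Q (a, n) : ℝ) / 2 ^ n ≤ (2:ℝ) ^ (-1 / ((a:ℝ) / 2 ^ n)) + 1 / 2 ^ n) ∧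
    (∀ a n : ℕ, 1 ≤ a → a ≤ 2 ^ n → 1 ≤ n → (Q (a, n) : ℝ) / 2 ^ n ≤ 1 / 2) := by
  obtain ⟨Q, hQ, hs⟩ := cp_find (α := ℕ × ℕ)
    (P := fun x q => leB (2 ^ (x.2 * x.1)) (q ^ x.1 * 2 ^ (2 ^ x.2))) (by fun_prop) (by
      rintro ⟨a, n⟩
      refine ⟨2 ^ n, ?_⟩
      rw [leB_iff, ← pow_mul]
      exact Nat.le_mul_of_pos_right _ (by positivity))
  have key : ∀ a n q : ℕ, 1 ≤ a → ((2 ^ (n * a) ≤ q ^ a * 2 ^ (2 ^ n)) ↔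
      (2:ℝ) ^ (-1 / ((a:ℝ) / 2 ^ n)) ≤ (q : ℝ) / 2 ^ n) := by
    intro a n q ha
    have ha' : (0:ℝ) < a := by exact_mod_cast ha
    rw [← pow_le_pow_iff_left₀ (M₀ := ℝ) (by positivity) (by positivity) (n := a) (by omega)]
    have : ((2:ℝ) ^ (-1 / ((a:ℝ) / 2 ^ n))) ^ a = 1 / 2 ^ (2 ^ n) := by
      rw [← Real.rpow_natCast, ← Real.rpow_mul (by norm_num)]
      have : (-1 / ((a:ℝ) / 2 ^ n)) * a = -((2 ^ n : ℕ) : ℝ) := by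
        push_cast
        field_simp
      rw [this, Real.rpow_neg (by norm_num), Real.rpow_natCast, one_div]
    rw [this, div_pow, ← pow_mul, div_le_div_iff₀ (by positivity) (by positivity), one_mul]
    exact_mod_cast Iff.rfl
  refine ⟨Q, hQ, ?_, ?_⟩
  · intro a n ha
    obtain ⟨h1, h2⟩ := hs (a, n)
    refine ⟨(key a n _ ha).1 (leB_iff.1 h1), ?_⟩
    rcases Nat.eq_zero_or_pos (Q (a, n)) with h | h
    · rw [h]; simp; positivity
    · have h3 := h2 (Q (a, n) - 1) (by omega)
      have h4 : ¬ ((2:ℝ) ^ (-1 / ((a:ℝ) / 2 ^ n)) ≤ ((Q (a, n) - 1 : ℕ) : ℝ) / 2 ^ n) := by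
        rw [← key a n _ ha, ← leB_iff]
        simp [h3]
      rw [Nat.cast_sub h, sub_div, not_le] at h4
      push_cast at h4
      linarith
  · intro a n ha han hn
    obtain ⟨h1, h2⟩ := hs (a, n)
    have : Q (a, n) ≤ 2 ^ (n - 1) := by
      by_contra hc
      have h3 := h2 (2 ^ (n - 1)) (by omega)
      have h4 : leB (2 ^ (n * a)) ((2 ^ (n - 1)) ^ a * 2 ^ (2 ^ n)) = true := by
        rw [leB_iff, ← pow_mul, ← pow_add]
        apply Nat.pow_le_pow_right (by norm_num)
        obtain ⟨k, rfl⟩ := Nat.exists_eq_add_of_le' hn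
        simp only [Nat.add_sub_cancel]
        nlinarith
      simp only at h3
      rw [h4] at h3
      cases h3
    have h5 : (Q (a, n) : ℝ) ≤ 2 ^ (n - 1) := by exact_mod_cast this
    obtain ⟨k, rfl⟩ := Nat.exists_eq_add_of_le' hn
    simp only [Nat.add_sub_cancel] at h5
    rw [div_le_div_iff₀ (by positivity) (by norm_num), pow_succ]
    linarith

/-- Value of a binary string, most significant bit first. -/
def bval (w : List Bool) : ℕ := w.foldl (fun a b => 2 * a + b.toNat) 0

theorem bval_append (w : List Bool) (b : Bool) : bval (w ++ [b]) = 2 * bval w + b.toNat := by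
  simp [bval, List.foldl_append]

theorem cp_bval : Computable bval := by
  have : Primrec bval := by
    refine Primrec.list_foldl (α := List Bool) (β := Bool) (σ := ℕ) (f := id) (g := fun _ => 0)
      (h := fun _ x => 2 * x.1 + x.2.toNat) Primrec.id (Primrec.const 0) ?_
    have hb : Primrec Bool.toNat := Primrec.dom_finite _
    exact (Primrec.nat_add.comp (Primrec.nat_mul.comp (Primrec.const 2)
      (Primrec.fst.comp Primrec.snd)) (hb.comp (Primrec.snd.comp Primrec.snd))).to₂
  exact this.to_comp

/-- The `n` lowest bits of `N`, most significant first. -/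
def outB (x : ℕ × ℕ) : List Bool :=
  (List.range x.1).map (fun i => eqB (x.2 / 2 ^ (x.1 - 1 - i) % 2) 1)

theorem length_outB (x : ℕ × ℕ) : (outB x).length = x.1 := by simp [outB]

theorem cp_outB : Computable outB := by
  have hp : Primrec₂ (fun a b : ℕ => a ^ b) := Primrec₂.unpaired'.1 Nat.Primrec.pow
  have h : Primrec outB := by
    refine Primrec.list_map (Primrec.list_range.comp Primrec.fst) ?_
    refine Primrec₂.mk ?_
    refine Primrec.eq.decide.comp (Primrec.nat_mod.comp (Primrec.nat_div.comp
      (Primrec.snd.comp Primrec.fst) (hp.comp (Primrec.const 2) (Primrec.nat_sub.comp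
        (Primrec.nat_sub.comp (Primrec.fst.comp Primrec.fst) (Primrec.const 1)) Primrec.snd)))
      (Primrec.const 2)) (Primrec.const 1)
  exact h.to_comp

theorem outB_succ (n N : ℕ) : outB (n + 1, N) = outB (n, N / 2) ++ [eqB (N % 2) 1] := by
  unfold outB
  rw [List.range_succ, List.map_append]
  congr 1
  · apply List.map_congr_left
    intro i hi
    have hi' : i < n := by simpa using hi
    simp only
    congr 2
    rw [Nat.div_div_eq_div_mul]
    congr 1
    have : n + 1 - 1 - i = (n - 1 - i) + 1 := by omega
    rw [this, pow_succ, mul_comm]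
  · simp

theorem bval_outB (n : ℕ) : ∀ N, N < 2 ^ n → bval (outB (n, N)) = N := by
  induction n with
  | zero => intro N hN; simp at hN; subst hN; rfl
  | succ n ih =>
    intro N hN
    rw [outB_succ, bval_append, ih _ (by rw [pow_succ] at hN; omega)]
    rcases Nat.mod_two_eq_zero_or_one N with h | h <;> simp [eqB, h] <;> omega

theorem firstBits_eq {T : ℝ} (h0 : 0 < T) (h1 : T < 1) (n : ℕ) :
    firstBits T n = outB (n, ⌊T * 2 ^ n⌋₊) := by
  unfold firstBits outB
  apply List.map_congr_left
  intro i hi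
  have hi' : i < n := by simpa using hi
  have hf : ⌊T⌋ = 0 := by
    rw [Int.floor_eq_iff]; constructor <;> push_cast <;> linarith
  have e1 : ⌊T * 2 ^ n⌋₊ / 2 ^ (n - 1 - i) = ⌊T * 2 ^ (i + 1)⌋₊ := by
    have h := Nat.floor_div_natCast (T * 2 ^ n) (2 ^ (n - 1 - i))
    rw [← h]
    congr 1
    push_cast
    have : n = (n - 1 - i) + (i + 1) := by omega
    rw [div_eq_iff (by positivity), mul_assoc, ← pow_add]
    congr 2
    omega
  simp only
  rw [e1]
  unfold bitOf eqB
  rw [hf]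
  simp only [Int.cast_zero, sub_zero]
  congr 1
  rw [← Int.natCast_floor_eq_floor (by positivity)]
  apply propext
  norm_cast

theorem floor_lt {T : ℝ} (h0 : 0 < T) (h1 : T < 1) (n : ℕ) : ⌊T * 2 ^ n⌋₊ < 2 ^ n := by
  rw [Nat.floor_lt (by positivity)]
  push_cast
  have : (0:ℝ) < 2 ^ n := by positivity
  nlinarith

theorem bval_firstBits {T : ℝ} (h0 : 0 < T) (h1 : T < 1) (n : ℕ) :
    bval (firstBits T n) = ⌊T * 2 ^ n⌋₊ := by
  rw [firstBits_eq h0 h1, bval_outB _ _ (floor_lt h0 h1 n)]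

theorem length_firstBits (T : ℝ) (n : ℕ) : (firstBits T n).length = n := by
  simp [firstBits]

/-- Unbounded search for a total Boolean predicate. -/
def rfB (P : ℕ → Bool) : Part ℕ := Nat.rfind (P : ℕ →. Bool)

theorem rfB_spec {P : ℕ → Bool} {n : ℕ} (h : n ∈ rfB P) : P n = true := by
  have := Nat.rfind_spec h
  simpa using this

theorem rfB_min {P : ℕ → Bool} {n m : ℕ} (h : n ∈ rfB P) (hm : P m = true) : n ≤ m := by
  by_contra hc
  have := Nat.rfind_min h (not_le.1 hc)
  simp [hm] at this

theorem rfB_exists {P : ℕ → Bool} {m : ℕ} (hm : P m = true) : ∃ n, n ∈ rfB P := by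
  obtain ⟨n, hn, -⟩ := Nat.rfind_min' (p := P) (m := m) hm
  exact ⟨n, hn⟩

theorem cp_rfind {α : Type*} [Primcodable α] {P : α → ℕ → Bool}
    (hP : Computable fun x : α × ℕ => P x.1 x.2) :
    Partrec (fun a => rfB (P a)) := by
  exact Partrec.rfind hP.partrec

theorem pdom_of_mem {α β : Type*} {f : α →. β} {a : α} {b : β} (h : b ∈ f a) : a ∈ f.Dom :=
  Part.dom_iff_mem.2 ⟨b, h⟩

theorem mem_of_pdom {α β : Type*} {f : α →. β} {a : α} (h : a ∈ f.Dom) : ∃ b, b ∈ f a :=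
  Part.dom_iff_mem.1 h

theorem weakly_random {U V : Computer} (hU : Optimal U) (hV : Optimal V) {T : ℝ}
    (h0 : 0 < T) (h1 : T < 1) (hZ : ComputableReal (Zfun V T)) : WeaklyChaitinTRandom U T T := by
  obtain ⟨A, hA1, hA2, hA3⟩ := exists_enum V
  have hA : IsEnum V A := ⟨hA1, hA2, hA3⟩
  obtain ⟨k0, p0, w0, hk0, hp0⟩ := exists_long hV hA
  obtain ⟨B, cB, hB⟩ := exists_geB hA1
  obtain ⟨O, cO, hO⟩ := exists_fresh hA
  obtain ⟨Q, cQ, hQ1, hQ2⟩ := exists_Q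
  set β := (2:ℝ) ^ (-1 / T) with hβ
  have hβ0 : 0 < β := phi_pos T
  have hβ1 : β < 1 / 2 := phi_lt_half h0 h1
  have hsum := hasSum_Z hA h0 h1.le
  rw [← hβ] at hsum
  set Z := Zfun V T
  have hZ0 : 0 ≤ Z := hsum.nonneg fun k => tm_nonneg A hβ0.le k
  obtain ⟨g, cg, hg⟩ := computableReal_nat hZ0 hZ
  have hps : ∀ s, ps A β s ≤ Z := fun s => sum_le_hasSum _ (fun k _ => tm_nonneg A hβ0.le k) hsum
  have hpl : Tendsto (ps A β) atTop (𝓝 Z) := hsum.tendsto_sum_nat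
  let P : List Bool → ℕ → Bool := fun w s =>
    B (s, Q (bval w + 1, w.length), w.length, g s + 2, s)
  have cP : Computable fun x : List Bool × ℕ => P x.1 x.2 := by
    have cb := cp_bval
    have cl : Computable (List.length : List Bool → ℕ) := Computable.list_length
    simp only [P]
    fun_prop
  have cF : Partrec (fun p : List Bool => (U.f p).bind fun w =>
      (rfB (P w)).map O) := by
    refine Partrec.bind U.partrec ?_
    refine Partrec.map ?_ ?_
    · exact (cp_rfind cP).comp Computable.snd
    · exact (cO.comp Computable.snd).to₂
  -- the numerical facts
  have hab : ∀ n : ℕ, 0 < n → ∃ b : ℝ, b = (Q (bval (firstBits T n) + 1, n) : ℝ) / 2 ^ n ∧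
      β < b ∧ b ≤ 1 / 2 ∧ b - β ≤ (1 / T ^ 2 + 1) / 2 ^ n := by
    intro n hn
    rw [bval_firstBits h0 h1]
    set a := ⌊T * 2 ^ n⌋₊ + 1 with ha
    have h2n : (0:ℝ) < 2 ^ n := by positivity
    have ha2 : a ≤ 2 ^ n := floor_lt h0 h1 n
    have hlt : T < (a : ℝ) / 2 ^ n := by
      rw [lt_div_iff₀ h2n]
      have := Nat.lt_floor_add_one (T * 2 ^ n)
      simpa [ha] using this
    have hle : (a : ℝ) / 2 ^ n - T ≤ 1 / 2 ^ n := by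
      have := Nat.floor_le (a := T * 2 ^ n) (by positivity)
      rw [sub_le_iff_le_add, div_le_iff₀ h2n, add_mul, one_div, inv_mul_cancel₀ h2n.ne']
      rw [ha]; push_cast; linarith
    have hle1 : (a : ℝ) / 2 ^ n ≤ 1 := by
      rw [div_le_one h2n]; exact_mod_cast ha2
    obtain ⟨q1, q2⟩ := hQ1 a n (by omega)
    refine ⟨_, rfl, ?_, hQ2 a n (by omega) ha2 hn, ?_⟩
    · have := phi_lower_up h0 hlt.le (by nlinarith)
      have h3 : 0 < β * (((a : ℝ) / 2 ^ n - T) / 3) := by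
        apply mul_pos hβ0; linarith
      linarith
    · have h4 := phi_upper h0 hlt.le
      have h5 : ((a : ℝ) / 2 ^ n - T) / T ^ 2 ≤ (1 / 2 ^ n) / T ^ 2 := by gcongr
      have h6 : (1 / T ^ 2 + 1) / 2 ^ n = (1 / 2 ^ n) / T ^ 2 + 1 / 2 ^ n := by
        field_simp
      rw [h6]; linarith
  have hsucc : ∀ n : ℕ, 0 < n → ∃ s, s ∈ rfB (P (firstBits T n)) := by
    intro n hn
    obtain ⟨b, hb, hb1, hb2, -⟩ := hab n hn
    set δ := β ^ (p0.length - 1) * (b - β) with hδ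
    have hδ0 : 0 < δ := mul_pos (by positivity) (by linarith)
    have e1 : ∀ᶠ s in atTop, Z - δ / 2 < ps A β s := hpl.eventually (lt_mem_nhds (by linarith))
    have e2 : ∀ᶠ s : ℕ in atTop, 4 * (1/2 : ℝ) ^ s < δ / 2 := by
      have : Tendsto (fun s : ℕ => 4 * (1/2 : ℝ) ^ s) atTop (𝓝 (4 * 0)) :=
        (tendsto_pow_atTop_nhds_zero_of_lt_one (by norm_num) (by norm_num)).const_mul 4
      exact this.eventually (gt_mem_nhds (by simp; exact hδ0))
    obtain ⟨s, f1, f2, f3⟩ := (e1.and (e2.and (eventually_gt_atTop k0))).exists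
    have : P (firstBits T n) s = true := by
      simp only [P]
      rw [hB, length_firstBits, ← hb]
      have l := ps_lower hk0 hp0 hβ0.le hβ0.le hb1.le hb1.le f3
      have gg := abs_le.1 (hg s)
      push_cast
      rw [add_div]
      rw [one_div, inv_pow] at f2
      have : (2:ℝ) / 2 ^ s = 2 * (2 ^ s)⁻¹ := rfl
      rw [this] at gg ⊢
      rw [← hδ] at l
      linarith
    exact rfB_exists this
  let C : Computer := ⟨_, cF, by
    obtain ⟨s, hs⟩ := hsucc 1 one_pos
    obtain ⟨p, hp, -⟩ := optimal_attained hU (firstBits T 1)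
    refine ⟨p, pdom_of_mem (b := O s) ?_⟩
    exact Part.mem_bind hp (Part.mem_map _ hs), by
    intro p hp q hq
    obtain ⟨_, hp⟩ := mem_of_pdom hp
    obtain ⟨_, hq⟩ := mem_of_pdom hq
    obtain ⟨_, hp, -⟩ := Part.mem_bind_iff.1 hp
    obtain ⟨_, hq, -⟩ := Part.mem_bind_iff.1 hq
    exact U.dom_prefixFree _ (pdom_of_mem hp) _ (pdom_of_mem hq)⟩
  obtain ⟨d, hd⟩ := optimal_le hV C
  obtain ⟨e, he⟩ := pow_unbounded_of_one_lt ((1 / T ^ 2 + 1) / (1 / 2 - β)) (one_lt_two (α := ℝ))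
  refine ⟨e + d, fun n hn => ?_⟩
  obtain ⟨s, hs⟩ := hsucc n hn
  obtain ⟨b, hb, hb1, hb2, hb3⟩ := hab n hn
  obtain ⟨pu, hpu, hlu⟩ := optimal_attained hU (firstBits T n)
  have hc : O s ∈ C.f pu := Part.mem_bind hpu (Part.mem_map _ hs)
  have hd' := hd _ _ hc
  rw [hlu] at hd'
  have hPs : P (firstBits T n) s = true := rfB_spec hs
  simp only [P] at hPs
  rw [hB, length_firstBits, ← hb] at hPs
  obtain ⟨p, hp, hpl'⟩ := optimal_attained hV (O s)
  obtain ⟨k, hk⟩ := (hA2 p (O s)).1 hp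
  have hks : s ≤ k := by
    by_contra h
    exact hO s k (by omega) p hk
  have t1 : ps A β s + β ^ p.length ≤ Z := by
    have := hps (k + 1)
    rw [ps, Finset.sum_range_succ, tm_some hk] at this
    have t2 : ps A β s ≤ ∑ x ∈ Finset.range k, tm A β x :=
      Finset.sum_le_sum_of_subset_of_nonneg (Finset.range_mono hks) (fun _ _ _ => tm_nonneg A hβ0.le _)
    linarith
  have t3 := ps_upper hA hβ0.le hβ1 hb1.le hb2 s
  have gg := abs_le.1 (hg s)
  push_cast at hPs
  rw [add_div] at hPs
  have hd0 : 0 < 1 / 2 - β := by linarith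
  have t4 : (b - β) / (1 / 2 - β) ≤ 2 ^ e / 2 ^ n := by
    calc (b - β) / (1 / 2 - β) ≤ ((1 / T ^ 2 + 1) / 2 ^ n) / (1 / 2 - β) := by gcongr
      _ = ((1 / T ^ 2 + 1) / (1 / 2 - β)) / 2 ^ n := by ring
      _ ≤ _ := by gcongr
  have t5 : β ^ p.length ≤ 2 ^ e / 2 ^ n := by linarith
  have t6 : β ^ p.length = (2:ℝ) ^ (-(p.length : ℝ) / T) := by
    rw [hβ, ← Real.rpow_natCast, ← Real.rpow_mul (by norm_num)]
    congr 1; ring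
  have t7 : (2:ℝ) ^ e / 2 ^ n = (2:ℝ) ^ ((e:ℝ) - n) := by
    rw [Real.rpow_sub (by norm_num), Real.rpow_natCast, Real.rpow_natCast]
  rw [t6, t7, Real.rpow_le_rpow_left_iff (by norm_num), div_le_iff₀ h0] at t5
  have t8 : (p.length : ℝ) ≤ complexity U (firstBits T n) + d := by
    rw [hpl']; exact_mod_cast hd'
  push_cast
  have : (e:ℝ) * T ≤ e := by
    have : (0:ℝ) ≤ e := by positivity
    nlinarith
  nlinarith

/-- Unary code of a natural number. -/
def unc (k : ℕ) : List Bool := (List.range k).map (fun _ => true) ++ [false]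

/-- Self-delimiting header followed by payload. -/
def encX (x : List ℕ × List Bool) : List Bool := x.1.flatMap unc ++ x.2

theorem unc_zero : unc 0 = [false] := rfl
theorem unc_succ (k : ℕ) : unc (k + 1) = true :: unc k := by
  simp [unc, List.range_succ_eq_map]

theorem length_unc (k : ℕ) : (unc k).length = k + 1 := by simp [unc]

theorem cp_encX : Computable encX := by
  have h1 : Primrec (fun k : ℕ => (List.range k).map (fun _ => true)) :=
    Primrec.list_map Primrec.list_range (Primrec.const true).to₂
  have h2 : Primrec unc := Primrec.list_append.comp h1 (Primrec.const [false])
  have h3 : Primrec encX :=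
    Primrec.list_append.comp (Primrec.list_flatMap Primrec.fst (h2.comp Primrec.snd).to₂) Primrec.snd
  exact h3.to_comp

theorem unc_prefix : ∀ (k k' : ℕ) (x y : List Bool), unc k ++ x <+: unc k' ++ y → k = k' ∧ x <+: y
  | 0, 0, x, y, h => by simpa [unc_zero] using h
  | 0, k' + 1, x, y, h => by simp [unc_zero, unc_succ] at h
  | k + 1, 0, x, y, h => by simp [unc_zero, unc_succ] at h
  | k + 1, k' + 1, x, y, h => by
    simp only [unc_succ, List.cons_append, List.cons_prefix_cons, true_and] at h
    obtain ⟨rfl, h2⟩ := unc_prefix k k' x y h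
    exact ⟨rfl, h2⟩

theorem encX_prefix : ∀ (h h' : List ℕ) (u u' : List Bool), h.length = h'.length →
    encX (h, u) <+: encX (h', u') → h = h' ∧ u <+: u'
  | [], [], u, u', _, hp => by simpa [encX] using hp
  | [], _ :: _, u, u', hl, hp => by simp at hl
  | _ :: _, [], u, u', hl, hp => by simp at hl
  | k :: h, k' :: h', u, u', hl, hp => by
    simp only [encX, List.flatMap_cons, List.append_assoc] at hp
    obtain ⟨rfl, h2⟩ := unc_prefix _ _ _ _ hp
    obtain ⟨rfl, h3⟩ := encX_prefix h h' u u' (by simpa using hl) h2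
    exact ⟨rfl, h3⟩

theorem unpair_le_sqrt (k : ℕ) : k.unpair.1 ≤ Nat.sqrt k ∧ k.unpair.2 ≤ Nat.sqrt k := by
  have h := Nat.max_sq_add_min_le_pair k.unpair.1 k.unpair.2
  rw [Nat.pair_unpair] at h
  have h2 : max k.unpair.1 k.unpair.2 ≤ Nat.sqrt k := by
    rw [Nat.le_sqrt']; omega
  exact ⟨(le_max_left _ _).trans h2, (le_max_right _ _).trans h2⟩

set_option maxHeartbeats 2000000 in
theorem compress_bound {U V : Computer} (hU : Optimal U) (hV : Optimal V) {T : ℝ}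
    (h0 : 0 < T) (h1 : T < 1) (hZ : ComputableReal (Zfun V T)) :
    ∃ c : ℕ, ∀ᶠ n : ℕ in atTop,
      (complexity U (firstBits T n) : ℝ) ≤ T * n + 4 * Nat.sqrt n + c := by
  obtain ⟨A, hA1, hA2, hA3⟩ := exists_enum V
  have hA : IsEnum V A := ⟨hA1, hA2, hA3⟩
  obtain ⟨k0, p0, w0, hk0, hp0⟩ := exists_long hV hA
  obtain ⟨B, cB, hB⟩ := exists_geB hA1
  obtain ⟨Q, cQ, hQ1, hQ2⟩ := exists_Q
  set β := (2:ℝ) ^ (-1 / T) with hβ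
  have hβ0 : 0 < β := phi_pos T
  have hβ1 : β < 1 / 2 := phi_lt_half h0 h1
  have hsum := hasSum_Z hA h0 h1.le
  rw [← hβ] at hsum
  have hOm := hasSum_Om hA
  have htail := fun {s m n : ℕ} => tail_bound hA h0 h1.le (s := s) (m := m) (n := n)
  rw [← hβ] at htail
  set Z := Zfun V T
  set Ω := Zfun V 1
  have hZ0 : 0 ≤ Z := hsum.nonneg fun k => tm_nonneg A hβ0.le k
  obtain ⟨g, cg, hg⟩ := computableReal_nat hZ0 hZ
  have hps : ∀ s, ps A β s ≤ Z := fun s => sum_le_hasSum _ (fun k _ => tm_nonneg A hβ0.le k) hsum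
  have hOl : Tendsto (ps A (1 / 2)) atTop (𝓝 Ω) := hOm.tendsto_sum_nat
  have hΩ0 : 0 < Ω := by
    have h := le_hasSum hOm k0 (fun k _ => tm_nonneg A (by norm_num) k)
    rw [tm_some hk0] at h
    have : (0:ℝ) < (1 / 2) ^ p0.length := by positivity
    linarith
  have hΩ1 : Ω ≤ 1 := le_of_tendsto' hOl (ps_half_le hA)
  set c0 := β ^ (p0.length - 1) with hc0
  have hc0p : 0 < c0 := by positivity
  set J : ℕ := ⌈9 / (c0 * β) + 3 * (2 / c0 + 1) / β⌉₊ + 1 with hJ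
  have hJr : 9 / (c0 * β) + 3 * (2 / c0 + 1) / β + 1 ≤ J := by
    rw [hJ]; push_cast
    linarith [Nat.le_ceil (9 / (c0 * β) + 3 * (2 / c0 + 1) / β)]
  have hJ1 : 9 ≤ c0 * (β * ((J : ℝ) - 1)) := by
    have : 9 / (c0 * β) ≤ (J : ℝ) - 1 := by
      have : 0 ≤ 3 * (2 / c0 + 1) / β := by positivity
      linarith
    rw [div_le_iff₀ (by positivity)] at this
    linarith
  have hJ2 : 3 * (2 / c0 + 1) / β ≤ J := by
    have : 0 ≤ 9 / (c0 * β) := by positivity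
    linarith
  let nf : List ℕ × List Bool → ℕ := fun x => Nat.pair (x.1.getD 0 0) (x.1.getD 1 0)
  let mf : List ℕ × List Bool → ℕ := fun x => Nat.pair (x.1.getD 2 0) (x.1.getD 3 0)
  let jf : List ℕ × List Bool → ℕ := fun x => x.1.getD 4 0
  let vf : List ℕ × List Bool → ℕ := fun x => bval x.2
  have cget : ∀ i : ℕ, Computable (fun x : List ℕ × List Bool => x.1.getD i 0) := fun i =>
    ((Primrec.list_getD 0).comp Primrec.fst (Primrec.const i)).to_comp
  have cnf : Computable nf := cp_pair (cget 0) (cget 1)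
  have cmf : Computable mf := cp_pair (cget 2) (cget 3)
  have cjf : Computable jf := cget 4
  have cvf : Computable vf := cp_bval.comp Computable.snd
  let R : List ℕ × List Bool → Bool := fun x => eqB x.1.length 5 && eqB x.2.length (mf x)
  have cR : Computable R := cp_and (cp_eq (Computable.list_length.comp Computable.fst) (cp_const 5))
    (cp_eq (Computable.list_length.comp Computable.snd) cmf)
  let P1 : List ℕ × List Bool → ℕ → Bool := fun x s => B (s + k0 + 1, 1, 1, vf x, mf x)
  let P2 : (List ℕ × List Bool) × ℕ → ℕ → Bool := fun x a =>
    B (x.2 + k0 + 1, Q (a + 1, nf x.1), nf x.1, g (nf x.1), nf x.1)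
  have cP1 : Computable fun x : (List ℕ × List Bool) × ℕ => P1 x.1 x.2 := by
    simp only [P1]; fun_prop
  have cP2 : Computable fun x : ((List ℕ × List Bool) × ℕ) × ℕ => P2 x.1 x.2 := by
    simp only [P2]; fun_prop
  let G : List ℕ × List Bool →. List Bool := fun x => (rfB (P1 x)).bind fun s =>
    (rfB (P2 (x, s))).map fun a => outB (nf x, a + 1 + jf x - J)
  have cG : Partrec G := by
    refine Partrec.bind (cp_rfind cP1) ?_
    refine Partrec.map (f := fun x : (List ℕ × List Bool) × ℕ => rfB (P2 x)) (cp_rfind cP2) ?_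
    have co := cp_outB
    have : Computable (fun y : ((List ℕ × List Bool) × ℕ) × ℕ =>
      outB (nf y.1.1, y.2 + 1 + jf y.1.1 - J)) := by fun_prop
    exact this.to₂
  have hn0 : ∀ᶠ n : ℕ in atTop, (J : ℝ) * (1/2 : ℝ) ^ n < 1 - T := by
    have : Tendsto (fun s : ℕ => (J : ℝ) * (1/2 : ℝ) ^ s) atTop (𝓝 (J * 0)) :=
      (tendsto_pow_atTop_nhds_zero_of_lt_one (by norm_num) (by norm_num)).const_mul _
    exact this.eventually (gt_mem_nhds (by simp; exact h1))
  have core : ∀ n : ℕ, (J : ℝ) * (1/2 : ℝ) ^ n < 1 - T → ∃ x, R x = true ∧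
      firstBits T n ∈ G x ∧ ((encX x).length : ℝ) ≤ T * n + 4 * Nat.sqrt n + (2 * J + 6) := by
    intro n hn
    have h2n : (0:ℝ) < 2 ^ n := by positivity
    set m := ⌈T * n⌉₊ with hm
    have hm1 : T * n ≤ m := Nat.le_ceil _
    have hm2 : (m : ℝ) < T * n + 1 := Nat.ceil_lt_add_one (by positivity)
    have hmn : m ≤ n := by
      rw [hm, Nat.ceil_le]
      have : (0:ℝ) ≤ n := by positivity
      nlinarith
    have h2m : (0:ℝ) < 2 ^ m := by positivity
    set v := ⌈Ω * 2 ^ m⌉₊ - 1 with hv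
    have hv0 : 1 ≤ ⌈Ω * 2 ^ m⌉₊ := Nat.one_le_ceil_iff.2 (by positivity)
    have hv1 : (v : ℝ) < Ω * 2 ^ m := by
      have := Nat.ceil_lt_add_one (a := Ω * 2 ^ m) (by positivity)
      rw [hv]; push_cast [hv0]; linarith
    have hv2 : Ω * 2 ^ m ≤ v + 1 := by
      have := Nat.le_ceil (Ω * 2 ^ m)
      rw [hv]; push_cast [hv0]; linarith
    have hv3 : v < 2 ^ m := by
      have : (v : ℝ) < 2 ^ m := by nlinarith
      exact_mod_cast this
    set F := ⌊T * 2 ^ n⌋₊ with hF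
    have hF1 : (F : ℝ) ≤ T * 2 ^ n := Nat.floor_le (by positivity)
    have hF2 : T * 2 ^ n < F + 1 := Nat.lt_floor_add_one _
    have hP1 : ∀ x s, mf x = m → vf x = v → (P1 x s = true ↔ (v:ℝ) / 2 ^ m ≤ ps A (1 / 2) (s + k0 + 1)) := by
      intro x s e1 e2
      simp only [P1]
      rw [hB, e1, e2]; norm_num
    have hP2 : ∀ x s a, nf x = n → (P2 (x, s) a = true ↔
        (g n:ℝ) / 2 ^ n ≤ ps A ((Q (a + 1, n) : ℝ) / 2 ^ n) (s + k0 + 1)) := by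
      intro x s a e1
      simp only [P2]
      rw [hB, e1]
    -- search for `s`
    let x0 : ℕ → List ℕ × List Bool := fun j =>
      ([n.unpair.1, n.unpair.2, m.unpair.1, m.unpair.2, j], outB (m, v))
    have hx1 : ∀ j, nf (x0 j) = n := fun j => Nat.pair_unpair n
    have hx2 : ∀ j, mf (x0 j) = m := fun j => Nat.pair_unpair m
    have hx3 : ∀ j, vf (x0 j) = v := fun j => bval_outB m v hv3
    have hx4 : ∀ j, jf (x0 j) = j := fun j => rfl
    have hs1 : ∃ s, ∀ j, s ∈ rfB (P1 (x0 j)) := by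
      have e : ∀ᶠ s in atTop, (v:ℝ) / 2 ^ m < ps A (1 / 2) s :=
        hOl.eventually (lt_mem_nhds (by rw [div_lt_iff₀ h2m]; exact hv1))
      obtain ⟨s, f1, f2⟩ := (e.and (eventually_ge_atTop (k0 + 1))).exists
      obtain ⟨s', rfl⟩ := Nat.exists_eq_add_of_le' f2
      obtain ⟨t, ht⟩ := rfB_exists ((hP1 (x0 0) s' (hx2 0) (hx3 0)).2 f1.le)
      exact ⟨t, fun j => ht⟩
    obtain ⟨s, hs⟩ := hs1
    have hs2 := (hP1 _ s (hx2 0) (hx3 0)).1 (rfB_spec (hs 0))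
    set S := s + k0 + 1 with hS
    have htl : Z - ps A β S ≤ 1 / 2 ^ n := by
      apply htail hm1
      rw [le_div_iff₀ h2m, sub_mul]
      rw [div_le_iff₀ h2m] at hs2
      linarith
    have gg := abs_le.1 (hg n)
    have hI : (2:ℝ) / 2 ^ n = 2 * (1 / 2 ^ n) := by ring
    rw [hI] at gg
    -- existence of `a`
    have hup : (g n:ℝ) / 2 ^ n ≤ ps A ((Q (F + J, n) : ℝ) / 2 ^ n) S := by
      set t : ℝ := ((F + J : ℕ) : ℝ) / 2 ^ n with ht
      have ht1 : t - T ≥ ((J:ℝ) - 1) / 2 ^ n := by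
        rw [ge_iff_le, div_le_iff₀ h2n, sub_mul, ht, div_mul_cancel₀ _ h2n.ne']
        push_cast; linarith
      have ht2 : t ≤ 1 := by
        rw [ht, div_le_one h2n]
        rw [one_div, inv_pow, ← div_eq_mul_inv, div_lt_iff₀ h2n] at hn
        push_cast; linarith
      have hJ0 : (1:ℝ) ≤ J := by rw [hJ]; push_cast; linarith [Nat.cast_nonneg (α := ℝ) ⌈9 / (c0 * β) + 3 * (2 / c0 + 1) / β⌉₊]
      have ht3 : T ≤ t := by
        have : 0 ≤ ((J:ℝ) - 1) / 2 ^ n := div_nonneg (by linarith) h2n.le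
        linarith
      have a1 := phi_lower_up h0 ht3 (by nlinarith)
      rw [← hβ] at a1
      have a2 := (hQ1 (F + J) n (by omega)).1
      rw [← ht] at a2
      set b : ℝ := (Q (F + J, n) : ℝ) / 2 ^ n
      have a3 : 0 ≤ β * ((t - T) / 3) := mul_nonneg hβ0.le (by linarith)
      have a4 := ps_lower hk0 hp0 hβ0.le hβ0.le (y := b) (by linarith) (by linarith) (s := S) (by omega)
      rw [← hc0] at a4
      have a5 : 3 * (1 / 2 ^ n) ≤ c0 * (b - β) := by
        have b1 : c0 * (β * (((J:ℝ) - 1) / 2 ^ n / 3)) ≤ c0 * (b - β) := by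
          apply mul_le_mul_of_nonneg_left _ hc0p.le
          refine le_trans ?_ (a1.trans (sub_le_sub_right a2 β))
          apply mul_le_mul_of_nonneg_left _ hβ0.le
          linarith
        have b2 : c0 * (β * (((J:ℝ) - 1) / 2 ^ n / 3)) = (c0 * (β * ((J:ℝ) - 1))) / 3 * (1 / 2 ^ n) := by
          ring
        have b3 : (0:ℝ) < 1 / 2 ^ n := by positivity
        rw [b2] at b1
        refine le_trans ?_ b1
        apply mul_le_mul_of_nonneg_right _ b3.le
        linarith
      linarith
    obtain ⟨a, ha⟩ : ∃ a, ∀ j, a ∈ rfB (P2 (x0 j, s)) := by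
      have : P2 (x0 0, s) (F + J - 1) = true := by
        rw [hP2 _ _ _ (hx1 0)]
        have : F + J - 1 + 1 = F + J := by omega
        rw [this]; exact hup
      obtain ⟨a, ha⟩ := rfB_exists this
      exact ⟨a, fun j => ha⟩
    have ha1 : a + 1 ≤ F + J := by
      have : P2 (x0 0, s) (F + J - 1) = true := by
        rw [hP2 _ _ _ (hx1 0)]
        have : F + J - 1 + 1 = F + J := by omega
        rw [this]; exact hup
      have := rfB_min (ha 0) this
      omega
    have ha2 := (hP2 _ s a (hx1 0)).1 (rfB_spec (ha 0))
    rw [← hS] at ha2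
    have ha3 : F ≤ a + 1 + J := by
      by_contra hcon
      have hcon' : a + 1 + J + 1 ≤ F := by omega
      have hconr : ((a + 1 : ℕ) : ℝ) + J + 1 ≤ F := by exact_mod_cast hcon'
      set t : ℝ := ((a + 1 : ℕ) : ℝ) / 2 ^ n with ht
      have ht0 : 0 < t := by positivity
      have htm : t * 2 ^ n = ((a + 1 : ℕ) : ℝ) := div_mul_cancel₀ _ h2n.ne'
      have htT : t ≤ T := by
        have : t * 2 ^ n ≤ T * 2 ^ n := by
          rw [htm]; linarith [Nat.cast_nonneg (α := ℝ) J]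
        exact le_of_mul_le_mul_right this h2n
      have d1 := phi_lower_down ht0 htT h1.le
      rw [← hβ] at d1
      have d2 := (hQ1 (a + 1) n (by omega)).2
      rw [← ht] at d2
      set b : ℝ := (Q (a + 1, n) : ℝ) / 2 ^ n
      have hb0 : 0 ≤ b := by positivity
      have d3 : c0 * (β - b) ≤ 2 * (1 / 2 ^ n) := by
        rcases le_total b β with h | h
        · have := ps_lower hk0 hp0 hβ0.le hb0 h le_rfl (s := S) (by omega)
          rw [← hc0] at this
          have := hps S
          linarith
        · have : c0 * (β - b) ≤ 0 := mul_nonpos_of_nonneg_of_nonpos hc0p.le (by linarith)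
          have : (0:ℝ) ≤ 1 / 2 ^ n := by positivity
          linarith
      have d4 : β - b ≤ 2 / c0 * (1 / 2 ^ n) := by
        rw [div_mul_eq_mul_div, le_div_iff₀ hc0p]; linarith
      have d5 : β * ((T - t) / 3) ≤ (2 / c0 + 1) * (1 / 2 ^ n) := by linarith
      have d6 : β * (T * 2 ^ n - t * 2 ^ n) ≤ 3 * (2 / c0 + 1) := by
        have := mul_le_mul_of_nonneg_right d5 h2n.le
        rw [mul_assoc (2 / c0 + 1), one_div, inv_mul_cancel₀ h2n.ne'] at this
        linarith
      have d7 : T * 2 ^ n - t * 2 ^ n ≤ 3 * (2 / c0 + 1) / β := by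
        rw [le_div_iff₀ hβ0]; linarith
      linarith
    set j := F + J - (a + 1) with hj
    refine ⟨x0 j, ?_, ?_, ?_⟩
    · simp only [R]
      rw [hx2]
      simp [x0, eqB, length_outB]
    · have : firstBits T n = outB (nf (x0 j), a + 1 + jf (x0 j) - J) := by
        rw [firstBits_eq h0 h1, hx1, hx4]
        congr 2
        omega
      rw [this]
      exact Part.mem_bind (hs j) (Part.mem_map _ (ha j))
    · have hl : (encX (x0 j)).length = n.unpair.1 + n.unpair.2 + m.unpair.1 + m.unpair.2 + j + 5 + m := by
        simp [encX, x0, length_unc, length_outB]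
        ring
      have q1 := unpair_le_sqrt n
      have q2 := unpair_le_sqrt m
      have q3 : Nat.sqrt m ≤ Nat.sqrt n := Nat.sqrt_le_sqrt hmn
      have q4 : (encX (x0 j)).length ≤ 4 * Nat.sqrt n + 2 * J + 5 + m := by
        rw [hl]; omega
      have q5 : ((encX (x0 j)).length : ℝ) ≤ 4 * Nat.sqrt n + 2 * J + 5 + m := by exact_mod_cast q4
      linarith
  have hpf : ∀ x y, R x = true → R y = true → encX x <+: encX y → x = y := by
    rintro ⟨h, u⟩ ⟨h', u'⟩ hx hy hxy
    simp only [R, Bool.and_eq_true, eqB_iff] at hx hy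
    obtain ⟨rfl, hu⟩ := encX_prefix h h' u u' (hx.1.trans hy.1.symm) hxy
    have : u = u' := hu.eq_of_length (hx.2.trans hy.2.symm)
    rw [this]
  obtain ⟨n1, hn1⟩ := hn0.exists
  obtain ⟨x1, hx1, hx2, -⟩ := core n1 hn1
  obtain ⟨C, hC⟩ := exists_computer cp_encX cR hpf cG ⟨x1, hx1, Part.dom_iff_mem.2 ⟨_, hx2⟩⟩
  obtain ⟨d, hd⟩ := optimal_le hU C
  refine ⟨2 * J + 6 + d, ?_⟩
  filter_upwards [hn0] with n hn
  obtain ⟨x, hx, hxG, hxl⟩ := core n hn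
  have := hd _ _ (hC x _ hx hxG)
  have : (complexity U (firstBits T n) : ℝ) ≤ (encX x).length + d := by exact_mod_cast this
  push_cast
  linarith

/-- Fixed point theorem for `Z`. If `V` is optimal, `T ∈ (0,1)`
and `Z_V(T)` is computable, then `T` is weakly Chaitin `T`-random and
`T`-compressible, hence `lim_{n→∞} H(T↾n)/n = T`. -/
theorem fixedPoint_of_partitionFunction_computable
    (U : Computer) (hU : Optimal U) (V : Computer) (hV : Optimal V)
    (T : ℝ) (hT : T ∈ Set.Ioo (0 : ℝ) 1) (hZ : ComputableReal (Zfun V T)) :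
    WeaklyChaitinTRandom U T T ∧ TCompressible U T T ∧
    Tendsto (fun n : ℕ => (complexity U (firstBits T n) : ℝ) / n) atTop (nhds T) := by
  obtain ⟨h0, h1⟩ := hT
  have hw := weakly_random hU hV h0 h1 hZ
  obtain ⟨c, hc⟩ := compress_bound hU hV h0 h1 hZ
  obtain ⟨c', hc'⟩ := hw
  have hlim : Tendsto (fun n : ℕ => (4 * (Nat.sqrt n : ℝ) + c) / n) atTop (𝓝 0) := by
    have e1 : Tendsto (fun n : ℕ => (4 + (c : ℝ)) / √(n : ℝ)) atTop (𝓝 0) :=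
      Tendsto.div_atTop tendsto_const_nhds
        (Real.tendsto_sqrt_atTop.comp tendsto_natCast_atTop_atTop)
    refine tendsto_of_tendsto_of_tendsto_of_le_of_le' tendsto_const_nhds e1
      (Eventually.of_forall fun n => by positivity) ?_
    filter_upwards [eventually_ge_atTop 1] with n hn
    have hn' : (1:ℝ) ≤ n := by exact_mod_cast hn
    have hs1 : (1:ℝ) ≤ √(n:ℝ) := Real.one_le_sqrt.2 hn'
    have hs2 : (Nat.sqrt n : ℝ) ≤ √(n:ℝ) := Real.nat_sqrt_le_real_sqrt
    have hs3 : √(n:ℝ) * √(n:ℝ) = n := Real.mul_self_sqrt (by linarith)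
    have hc0 : (0:ℝ) ≤ c := by positivity
    rw [div_le_div_iff₀ (by linarith) (by linarith)]
    have : 4 * (Nat.sqrt n : ℝ) + c ≤ (4 + c) * √(n:ℝ) := by nlinarith
    calc _ ≤ ((4 + c) * √(n:ℝ)) * √(n:ℝ) := by gcongr
      _ = _ := by rw [mul_assoc, hs3]
  have hlim2 : Tendsto (fun n : ℕ => (c' : ℝ) / n) atTop (𝓝 0) :=
    tendsto_const_div_atTop_nhds_zero_nat _
  refine ⟨⟨c', hc'⟩, ⟨fun n => max 0 ((complexity U (firstBits T n) : ℝ) - T * n), ?_, ?_⟩, ?_⟩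
  · refine tendsto_of_tendsto_of_tendsto_of_le_of_le' tendsto_const_nhds hlim
      (Eventually.of_forall fun n => by positivity) ?_
    filter_upwards [hc] with n hn
    apply div_le_div_of_nonneg_right _ (by positivity)
    apply max_le (by positivity)
    linarith
  · intro n _
    have := le_max_right 0 ((complexity U (firstBits T n) : ℝ) - T * n)
    linarith
  · have l1 : Tendsto (fun n : ℕ => T - (c' : ℝ) / n) atTop (𝓝 T) := by
      simpa using hlim2.const_sub T
    have l2 : Tendsto (fun n : ℕ => T + (4 * (Nat.sqrt n : ℝ) + c) / n) atTop (𝓝 T) := by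
      simpa using hlim.const_add T
    refine tendsto_of_tendsto_of_tendsto_of_le_of_le' l1 l2 ?_ ?_
    · filter_upwards [eventually_ge_atTop 1] with n hn
      have hn' : (0:ℝ) < n := by exact_mod_cast hn
      rw [le_div_iff₀ hn', sub_mul, div_mul_cancel₀ _ hn'.ne']
      exact hc' n hn
    · filter_upwards [eventually_ge_atTop 1, hc] with n hn hcn
      have hn' : (0:ℝ) < n := by exact_mod_cast hn
      rw [div_le_iff₀ hn', add_mul, div_mul_cancel₀ _ hn'.ne']
      linarith
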